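/- arXiv:1009.4626 — 15 statements merged into one kernel-verified Lean document; each statement's English description precedes it below -/
import Mathlib

section
/- If there exists an O(n,k,a) omnimosaic, i.e. an n×n matrix over an alphabet of size a containing every k×k matrix over that alphabet as a submatrix, then C(n,k)^2 ≥ a^(k^2), where C(n,k) denotes the binomial coefficient. -/
/-- An `O(n,k,a)` omnimosaic (stated for possibly rectangular `m × n` arrays):
a matrix over the alphabet `Fin a` containing every `k × k` matrix over that
alphabet as a submatrix. -/
def IsOmnimosaic (a k : ℕ) {m n : ℕ} (M : Fin m → Fin n → Fin a) : Prop :=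
  ∀ T : Fin k → Fin k → Fin a, ∃ ρ : Fin k → Fin m, ∃ σ : Fin k → Fin n,
    StrictMono ρ ∧ StrictMono σ ∧ ∀ i j, T i j = M (ρ i) (σ j)

theorem pigeonhole_bound (n k a : ℕ) (hn : 1 ≤ n) (hk : 1 ≤ k) (ha : 2 ≤ a)
    (h : ∃ M : Fin n → Fin n → Fin a, IsOmnimosaic a k M) :
    (n.choose k) ^ 2 ≥ a ^ (k ^ 2) := by
  classical
  obtain ⟨M, hM⟩ := h
  choose ρ σ hρ hσ hT using hM
  have key : Fintype.card (Fin k → Fin k → Fin a) ≤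
      ((Finset.powersetCard k (Finset.univ : Finset (Fin n))) ×ˢ
        (Finset.powersetCard k (Finset.univ : Finset (Fin n)))).card := by
    rw [← Finset.card_univ]
    apply Finset.card_le_card_of_injOn
      (fun T => (Finset.univ.image (ρ T), Finset.univ.image (σ T)))
    · intro T _
      simp [Finset.mem_powersetCard, Finset.card_image_of_injective _ (hρ T).injective,
        Finset.card_image_of_injective _ (hσ T).injective]
    · intro T _ T' _ hTT
      simp only [Prod.mk.injEq] at hTT
      have h1 : ρ T = ρ T' := by
        refine ((hρ T).range_inj (hρ T')).1 ?_
        have := congrArg (fun s : Finset (Fin n) => (s : Set (Fin n))) hTT.1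
        simpa using this
      have h2 : σ T = σ T' := by
        refine ((hσ T).range_inj (hσ T')).1 ?_
        have := congrArg (fun s : Finset (Fin n) => (s : Set (Fin n))) hTT.2
        simpa using this
      funext i j
      rw [hT T i j, hT T' i j, h1, h2]
  have h3 : Fintype.card (Fin k → Fin k → Fin a) = a ^ (k ^ 2) := by
    simp [← pow_mul, sq]
  rw [h3, Finset.card_product, Finset.card_powersetCard, Finset.card_univ, Fintype.card_fin,
    ← sq] at key
  exact key
end

section
/- If there exists an O(n,k,a) omnimosaic, then (n : ℝ) ≥ k · a^(k/2) / e, where e is Euler's number and a^(k/2) means the real number a raised to the power k/2. -/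
theorem omni_card (n k a : ℕ) (M : Fin n → Fin n → Fin a) (h : IsOmnimosaic a k M) :
    a ^ (k * k) ≤ (n.choose k) ^ 2 := by
  classical
  choose ρ σ hρ hσ hM using h
  let f : (Fin k → Fin k → Fin a) → Finset (Fin n) × Finset (Fin n) :=
    fun T => (Finset.univ.image (ρ T), Finset.univ.image (σ T))
  have hf : Function.Injective f := by
    intro T S hTS
    have h1 : Finset.univ.image (ρ T) = Finset.univ.image (ρ S) := congrArg Prod.fst hTS
    have h2 : Finset.univ.image (σ T) = Finset.univ.image (σ S) := congrArg Prod.snd hTS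
    have e1 : ρ T = ρ S := ((hρ T).range_inj (hρ S)).1 (by
      simpa using congrArg (fun s : Finset (Fin n) => (s : Set (Fin n))) h1)
    have e2 : σ T = σ S := ((hσ T).range_inj (hσ S)).1 (by
      simpa using congrArg (fun s : Finset (Fin n) => (s : Set (Fin n))) h2)
    funext i j
    rw [hM T i j, hM S i j, e1, e2]
  have := Finset.card_le_card_of_injOn (s := Finset.univ)
    (t := (Finset.powersetCard k Finset.univ) ×ˢ (Finset.powersetCard k Finset.univ)) f
    (by
      intro T _
      simp [f, Finset.mem_powersetCard, Finset.card_image_of_injective _ (hρ T).injective,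
        Finset.card_image_of_injective _ (hσ T).injective])
    hf.injOn
  simpa [Finset.card_product, ← pow_mul, ← sq] using this

theorem lower_bound_real (n k a : ℕ) (hn : 1 ≤ n) (hk : 1 ≤ k) (ha : 2 ≤ a)
    (h : ∃ M : Fin n → Fin n → Fin a, IsOmnimosaic a k M) :
    (n : ℝ) ≥ (k : ℝ) * (a : ℝ) ^ ((k : ℝ) / 2) / Real.exp 1 := by
  obtain ⟨M, hM⟩ := h
  have h1 : ((a : ℝ) ^ (k * k)) ≤ ((n.choose k : ℕ) : ℝ) ^ 2 := by
    exact_mod_cast omni_card n k a M hM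
  have h2 : ((n.choose k : ℕ) : ℝ) ≤ (n : ℝ) ^ k / (k.factorial : ℝ) :=
    Nat.choose_le_pow_div k n
  have h3 : (k : ℝ) ^ k / (k.factorial : ℝ) ≤ Real.exp k :=
    Real.pow_div_factorial_le_exp _ (by positivity) _
  have hk0 : (0 : ℝ) < k := by exact_mod_cast hk
  have hfac : (0 : ℝ) < k.factorial := by positivity
  have ha0 : (0 : ℝ) ≤ a := by positivity
  set x : ℝ := (a : ℝ) ^ ((k : ℝ) / 2) with hx
  have hx0 : 0 ≤ x := by positivity
  have hx2 : x ^ 2 = (a : ℝ) ^ k := by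
    rw [hx, ← Real.rpow_natCast, ← Real.rpow_mul ha0, ← Real.rpow_natCast]
    congr 1
    push_cast
    ring
  have h4 : x ^ k ≤ ((n.choose k : ℕ) : ℝ) := by
    refine (pow_le_pow_iff_left₀ (n := 2) (by positivity) (by positivity) (by norm_num)).1 ?_
    rw [← pow_mul, mul_comm k 2, pow_mul, hx2, ← pow_mul]
    exact h1
  have he : Real.exp (k : ℝ) = Real.exp 1 ^ k := by
    rw [← Real.exp_nat_mul, mul_one]
  have h5 : ((k : ℝ) * x) ^ k ≤ ((n : ℝ) * Real.exp 1) ^ k := by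
    rw [mul_pow, mul_pow, ← he]
    rw [div_le_iff₀ hfac] at h3
    have h6 := h4.trans h2
    rw [le_div_iff₀ hfac] at h6
    calc (k : ℝ) ^ k * x ^ k ≤ (Real.exp k * k.factorial) * x ^ k := by gcongr
      _ = (x ^ k * k.factorial) * Real.exp k := by ring
      _ ≤ (n : ℝ) ^ k * Real.exp k := by gcongr
  have h7 : (k : ℝ) * x ≤ n * Real.exp 1 :=
    (pow_le_pow_iff_left₀ (by positivity) (by positivity) (by omega)).1 h5
  rw [ge_iff_le, div_le_iff₀ (Real.exp_pos 1)]
  exact h7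
end

section
/- ω(2,3) = 6; that is, there exists a 6×6 matrix over a 3-letter alphabet containing every 2×2 matrix over that alphabet as a submatrix, and no n×n matrix with n ≤ 5 over a 3-letter alphabet contains every 2×2 matrix over that alphabet as a submatrix. -/
namespace Omni

/-- Indicator of equality of two naturals. -/
def q (u v : ℕ) : ℕ := bif Nat.beq u v then 1 else 0

/-- Number of positions `c < d` of the row `a b c d f` carrying the letters `x, y`. -/
def eL (a b c d f x y : ℕ) : ℕ :=
  q a x * (q b y + (q c y + (q d y + q f y))) + (q b x * (q c y + (q d y + q f y)) +
    (q c x * (q d y + q f y) + q d x * q f y))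

/-- Number of occurrences of a letter in a row. -/
def cL (a b c d f x : ℕ) : ℕ := q a x + (q b x + (q c x + (q d x + q f x)))

def er (w : Fin 5 → Fin 3) (x y : ℕ) : ℕ := eL (w 0) (w 1) (w 2) (w 3) (w 4) x y
def cr (w : Fin 5 → Fin 3) (x : ℕ) : ℕ := cL (w 0) (w 1) (w 2) (w 3) (w 4) x
def rowL (w : Fin 5 → Fin 3) : List ℕ := [w 0, w 1, w 2, w 3, w 4]

/-- The pattern condition in elementary form. -/
def Has (M : Fin 5 → Fin 5 → Fin 3) : Prop :=
  ∀ x y z w : Fin 3, ∃ i j c d : Fin 5, i < j ∧ c < d ∧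
    M i c = x ∧ M i d = y ∧ M j c = z ∧ M j d = w

theorem Has.transpose {M} (h : Has M) : Has (fun i j => M j i) := by
  intro x y z w
  obtain ⟨i, j, c, d, h1, h2, h3, h4, h5, h6⟩ := h x z y w
  exact ⟨c, d, i, j, h2, h1, h3, h5, h4, h6⟩

theorem Has.flip {M} (h : Has M) : Has (fun i => M (Fin.rev i)) := by
  intro x y z w
  obtain ⟨i, j, c, d, h1, h2, h3, h4, h5, h6⟩ := h z w x y
  refine ⟨Fin.rev j, Fin.rev i, c, d, by simpa using h1, h2, ?_⟩
  simp [h3, h4, h5, h6]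

theorem er_eq_sum (w : Fin 5 → Fin 3) (x y : Fin 3) :
    (∑ c : Fin 5, ∑ d : Fin 5, if c < d ∧ w c = x ∧ w d = y then 1 else 0) = er w x y := by
  have hq : ∀ u v : Fin 3, q u v = if u = v then 1 else 0 := by decide
  simp only [er, eL, hq, Fin.sum_univ_five]
  simp [ite_and]
  split_ifs <;> rfl

theorem top {M} (h : Has M) (x y : Fin 3) :
    9 ≤ 4 * er (M 0) x y + 3 * er (M 1) x y + 2 * er (M 2) x y + er (M 3) x y := by
  classical
  let S : Finset ((Fin 5 × Fin 5) × (Fin 5 × Fin 5)) := Finset.univ.filter fun p =>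
    p.1.1 < p.1.2 ∧ (p.2.1 < p.2.2 ∧ M p.1.1 p.2.1 = x ∧ M p.1.1 p.2.2 = y)
  have h1 : (Finset.univ : Finset (Fin 3 × Fin 3)) ⊆
      S.image (fun p => (M p.1.2 p.2.1, M p.1.2 p.2.2)) := by
    rintro ⟨z, w⟩ -
    obtain ⟨i, j, c, d, h1, h2, h3, h4, h5, h6⟩ := h x y z w
    refine Finset.mem_image.2 ⟨((i, j), (c, d)), ?_, ?_⟩
    · simp [S, h1, h2, h3, h4]
    · simp [h5, h6]
  have h2 := (Finset.card_le_card h1).trans Finset.card_image_le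
  have h3 : S.card = ∑ i : Fin 5, ∑ j : Fin 5, if i < j then er (M i) x y else 0 := by
    rw [Finset.card_filter, Fintype.sum_prod_type, Fintype.sum_prod_type]
    refine Finset.sum_congr rfl fun i _ => Finset.sum_congr rfl fun j _ => ?_
    rw [Fintype.sum_prod_type]
    by_cases hij : i < j
    · simp only [hij, true_and, if_true]
      exact er_eq_sum (M i) x y
    · simp [hij]
  rw [h3] at h2
  simp [Fin.sum_univ_five] at h2
  omega

theorem bot {M} (h : Has M) (x y : Fin 3) :
    9 ≤ er (M 1) x y + 2 * er (M 2) x y + 3 * er (M 3) x y + 4 * er (M 4) x y := by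
  have := top h.flip x y
  simp only [show Fin.rev (0 : Fin 5) = 4 from rfl, show Fin.rev (1 : Fin 5) = 3 from rfl,
    show Fin.rev (2 : Fin 5) = 2 from rfl, show Fin.rev (3 : Fin 5) = 1 from rfl] at this
  omega

/-! ### Phase 1: letter counts of the rows -/

/-- All letter count vectors of a row. -/
def comps : List (ℕ × ℕ × ℕ) :=
  [(0,0,5),(0,1,4),(0,2,3),(0,3,2),(0,4,1),(0,5,0),(1,0,4),(1,1,3),(1,2,2),(1,3,1),(1,4,0),
   (2,0,3),(2,1,2),(2,2,1),(2,3,0),(3,0,2),(3,1,1),(3,2,0),(4,0,1),(4,1,0),(5,0,0)]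

def code (p : ℕ × ℕ × ℕ) : ℕ := 6 * p.1 + p.2.1

/-- The surviving tuples of letter counts (codes `6 * n₀ + n₁`). -/
def fin : List (ℕ × ℕ × ℕ × ℕ × ℕ) :=
  [(7, 15, 18, 2, 14),
   (7, 20, 3, 12, 14),
   (8, 12, 20, 3, 13),
   (8, 15, 18, 2, 14),
   (8, 18, 15, 2, 13),
   (8, 18, 15, 2, 19),
   (8, 20, 12, 3, 14),
   (8, 20, 12, 3, 19),
   (9, 12, 20, 3, 13),
   (9, 18, 2, 15, 13),
   (13, 2, 15, 18, 8),
   (13, 3, 20, 12, 8),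
   (13, 3, 20, 12, 9),
   (13, 15, 2, 18, 9),
   (13, 15, 2, 18, 14),
   (13, 20, 3, 12, 14),
   (14, 2, 18, 15, 7),
   (14, 2, 18, 15, 8),
   (14, 3, 12, 20, 8),
   (14, 12, 3, 20, 7),
   (14, 12, 3, 20, 13),
   (14, 18, 2, 15, 13),
   (19, 2, 15, 18, 8),
   (19, 3, 12, 20, 8)]

def eq5 (a b : ℕ × ℕ × ℕ × ℕ × ℕ) : Bool :=
  Nat.beq a.1 b.1 && (Nat.beq a.2.1 b.2.1 && (Nat.beq a.2.2.1 b.2.2.1 &&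
    (Nat.beq a.2.2.2.1 b.2.2.2.1 && Nat.beq a.2.2.2.2 b.2.2.2.2)))

def lin (k a b c d : ℕ) : Bool := Nat.ble k (4 * a + 3 * b + 2 * c + d)

def sq (n : ℕ) : ℕ := n * (n - 1)

def t3 (p0 p1 p2 : ℕ × ℕ × ℕ) : Bool :=
  lin 12 (p0.1 * p0.2.1) (p1.1 * p1.2.1) (p2.1 * p2.2.1) 0 &&
  (lin 12 (p0.1 * p0.2.2) (p1.1 * p1.2.2) (p2.1 * p2.2.2) 0 &&
  lin 12 (p0.2.1 * p0.2.2) (p1.2.1 * p1.2.2) (p2.2.1 * p2.2.2) 0)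

def t4 (p0 p1 p2 p3 : ℕ × ℕ × ℕ) : Bool :=
  lin 18 (p0.1 * p0.2.1) (p1.1 * p1.2.1) (p2.1 * p2.2.1) (p3.1 * p3.2.1) &&
  (lin 18 (p0.1 * p0.2.2) (p1.1 * p1.2.2) (p2.1 * p2.2.2) (p3.1 * p3.2.2) &&
  (lin 18 (p0.2.1 * p0.2.2) (p1.2.1 * p1.2.2) (p2.2.1 * p2.2.2) (p3.2.1 * p3.2.2) &&
  (lin 18 (sq p0.1) (sq p1.1) (sq p2.1) (sq p3.1) &&
  (lin 18 (sq p0.2.1) (sq p1.2.1) (sq p2.2.1) (sq p3.2.1) &&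
  lin 18 (sq p0.2.2) (sq p1.2.2) (sq p2.2.2) (sq p3.2.2)))))

def phase1 : Bool :=
  comps.all fun p0 => comps.all fun p1 => comps.all fun p2 => !(t3 p0 p1 p2) ||
    comps.all fun p3 => !(t4 p0 p1 p2 p3) || comps.all fun p4 => !(t4 p4 p3 p2 p1) ||
      fin.any (eq5 (code p0, code p1, code p2, code p3, code p4))

theorem phase1_true : phase1 = true := by decide +kernel

def comp (w : Fin 5 → Fin 3) : ℕ × ℕ × ℕ := (cr w 0, cr w 1, cr w 2)

theorem forall_row {Q : (Fin 5 → Fin 3) → Prop}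
    (h : ∀ a b c d f : Fin 3, Q ![a, b, c, d, f]) (w : Fin 5 → Fin 3) : Q w := by
  have : w = ![w 0, w 1, w 2, w 3, w 4] := by
    funext i; fin_cases i <;> rfl
  rw [this]; exact h _ _ _ _ _

theorem comp_mem (w : Fin 5 → Fin 3) : comp w ∈ comps := by
  revert w; apply forall_row; decide +kernel

theorem row_facts (w : Fin 5 → Fin 3) :
    er w 0 1 + er w 1 0 = cr w 0 * cr w 1 ∧ er w 0 2 + er w 2 0 = cr w 0 * cr w 2 ∧
    er w 1 2 + er w 2 1 = cr w 1 * cr w 2 ∧ er w 0 0 + er w 0 0 = sq (cr w 0) ∧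
    er w 1 1 + er w 1 1 = sq (cr w 1) ∧ er w 2 2 + er w 2 2 = sq (cr w 2) ∧
    cr w 0 * cr w 1 ≤ 6 ∧ cr w 0 * cr w 2 ≤ 6 ∧ cr w 1 * cr w 2 ≤ 6 := by
  revert w; apply forall_row; decide +kernel

theorem t4_of {w0 w1 w2 w3 : Fin 5 → Fin 3}
    (h : ∀ x y : Fin 3, 9 ≤ 4 * er w0 x y + 3 * er w1 x y + 2 * er w2 x y + er w3 x y) :
    t4 (comp w0) (comp w1) (comp w2) (comp w3) = true := by
  obtain ⟨a1, a2, a3, a4, a5, a6, -⟩ := row_facts w0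
  obtain ⟨b1, b2, b3, b4, b5, b6, -⟩ := row_facts w1
  obtain ⟨c1, c2, c3, c4, c5, c6, -⟩ := row_facts w2
  obtain ⟨d1, d2, d3, d4, d5, d6, -⟩ := row_facts w3
  have h00 := h 0 0
  have h01 := h 0 1
  have h02 := h 0 2
  have h10 := h 1 0
  have h11 := h 1 1
  have h12 := h 1 2
  have h20 := h 2 0
  have h21 := h 2 1
  have h22 := h 2 2
  simp only [Fin.val_zero, Fin.val_one, Fin.val_two] at h00 h01 h02 h10 h11 h12 h20 h21 h22
  simp only [t4, comp, lin, Bool.and_eq_true, Nat.ble_eq, ← a1, ← a2, ← a3, ← a4, ← a5, ← a6,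
    ← b1, ← b2, ← b3, ← b4, ← b5, ← b6, ← c1, ← c2, ← c3, ← c4, ← c5, ← c6,
    ← d1, ← d2, ← d3, ← d4, ← d5, ← d6]
  refine ⟨?_, ?_, ?_, ?_, ?_, ?_⟩ <;> omega

theorem t3_of {w0 w1 w2 w3 : Fin 5 → Fin 3}
    (h : t4 (comp w0) (comp w1) (comp w2) (comp w3) = true) :
    t3 (comp w0) (comp w1) (comp w2) = true := by
  obtain ⟨-, -, -, -, -, -, d1, d2, d3⟩ := row_facts w3
  simp only [t4, t3, comp, lin, Bool.and_eq_true, Nat.ble_eq] at *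
  obtain ⟨h1, h2, h3, -⟩ := h
  refine ⟨?_, ?_, ?_⟩ <;> omega

theorem eq5_eq {a b} (h : eq5 a b = true) : a = b := by
  obtain ⟨a1, a2, a3, a4, a5⟩ := a
  obtain ⟨b1, b2, b3, b4, b5⟩ := b
  simpa [eq5] using h

def codes (M : Fin 5 → Fin 5 → Fin 3) : ℕ × ℕ × ℕ × ℕ × ℕ :=
  (code (comp (M 0)), code (comp (M 1)), code (comp (M 2)), code (comp (M 3)), code (comp (M 4)))

theorem codes_mem {M} (h : Has M) : codes M ∈ fin := by
  have h1 := t4_of (top h)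
  have h2 : t4 (comp (M 4)) (comp (M 3)) (comp (M 2)) (comp (M 1)) = true := by
    apply t4_of; intro x y; have := bot h x y; omega
  have h3 := t3_of h1
  have key := phase1_true
  rw [phase1, List.all_eq_true] at key
  have key := key _ (comp_mem (M 0))
  rw [List.all_eq_true] at key
  have key := key _ (comp_mem (M 1))
  rw [List.all_eq_true] at key
  have key := key _ (comp_mem (M 2))
  rw [h3, Bool.not_true, Bool.false_or, List.all_eq_true] at key
  have key := key _ (comp_mem (M 3))
  rw [h1, Bool.not_true, Bool.false_or, List.all_eq_true] at key
  have key := key _ (comp_mem (M 4))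
  rw [h2, Bool.not_true, Bool.false_or, List.any_eq_true] at key
  obtain ⟨x, hx, hx'⟩ := key
  rw [codes, eq5_eq hx']; exact hx

/-! ### Phase 2: the rows themselves -/

/-- Rows with letter counts (0, 2, 3), each with its packed pair counts. -/
def tab2 : List (ℕ × List ℕ) :=
  [(55340238822493388800, [1,1,2,2,2]),
   (55412295317019688960, [1,2,1,2,2]),
   (55484351811545989120, [1,2,2,1,2]),
   (55556408306072289280, [1,2,2,2,1]),
   (55484351811545989120, [2,1,1,2,2]),
   (55556408306072289280, [2,1,2,1,2]),
   (55628464800598589440, [2,1,2,2,1]),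
   (55628464800598589440, [2,2,1,1,2]),
   (55700521295124889600, [2,2,1,2,1]),
   (55772577789651189760, [2,2,2,1,1])]

/-- Rows with letter counts (0, 3, 2), each with its packed pair counts. -/
def tab3 : List (ℕ × List ℕ) :=
  [(18446750683664220160, [1,1,1,2,2]),
   (18518807178190520320, [1,1,2,1,2]),
   (18590863672716820480, [1,1,2,2,1]),
   (18590863672716820480, [1,2,1,1,2]),
   (18662920167243120640, [1,2,1,2,1]),
   (18734976661769420800, [1,2,2,1,1]),
   (18662920167243120640, [2,1,1,1,2]),
   (18734976661769420800, [2,1,1,2,1]),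
   (18807033156295720960, [2,1,2,1,1]),
   (18879089650822021120, [2,2,1,1,1])]

/-- Rows with letter counts (1, 1, 3), each with its packed pair counts. -/
def tab7 : List (ℕ × List ℕ) :=
  [(55340235519663735040, [0,1,2,2,2]),
   (55412292014190035200, [0,2,1,2,2]),
   (55484348508716335360, [0,2,2,1,2]),
   (55556405003242635520, [0,2,2,2,1]),
   (55340235519680512000, [1,0,2,2,2]),
   (55340516994657157120, [1,2,0,2,2]),
   (55340798469633802240, [1,2,2,0,2]),
   (55341079944610447360, [1,2,2,2,0]),
   (55412573489166680320, [2,0,1,2,2]),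
   (55484629983692980480, [2,0,2,1,2]),
   (55556686478219280640, [2,0,2,2,1]),
   (55412573489183457280, [2,1,0,2,2]),
   (55412854964160102400, [2,1,2,0,2]),
   (55413136439136747520, [2,1,2,2,0]),
   (55484911458669625600, [2,2,0,1,2]),
   (55556967953195925760, [2,2,0,2,1]),
   (55484911458686402560, [2,2,1,0,2]),
   (55485192933663047680, [2,2,1,2,0]),
   (55557249428172570880, [2,2,2,0,1]),
   (55557249428189347840, [2,2,2,1,0])]

/-- Rows with letter counts (1, 2, 2), each with its packed pair counts. -/
def tab8 : List (ℕ × List ℕ) :=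
  [(18446748476051161600, [0,1,1,2,2]),
   (18518804970577461760, [0,1,2,1,2]),
   (18590861465103761920, [0,1,2,2,1]),
   (18590861465103761920, [0,2,1,1,2]),
   (18662917959630062080, [0,2,1,2,1]),
   (18734974454156362240, [0,2,2,1,1]),
   (18446748476067938560, [1,0,1,2,2]),
   (18518804970594238720, [1,0,2,1,2]),
   (18590861465120538880, [1,0,2,2,1]),
   (18446748476084715520, [1,1,0,2,2]),
   (18447029951061360640, [1,1,2,0,2]),
   (18447311426038005760, [1,1,2,2,0]),
   (18519086445570883840, [1,2,0,1,2]),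
   (18591142940097184000, [1,2,0,2,1]),
   (18519086445587660800, [1,2,1,0,2]),
   (18519367920564305920, [1,2,1,2,0]),
   (18591424415073829120, [1,2,2,0,1]),
   (18591424415090606080, [1,2,2,1,0]),
   (18591142940080407040, [2,0,1,1,2]),
   (18663199434606707200, [2,0,1,2,1]),
   (18735255929133007360, [2,0,2,1,1]),
   (18591142940097184000, [2,1,0,1,2]),
   (18663199434623484160, [2,1,0,2,1]),
   (18591142940113960960, [2,1,1,0,2]),
   (18591424415090606080, [2,1,1,2,0]),
   (18663480909600129280, [2,1,2,0,1]),
   (18663480909616906240, [2,1,2,1,0]),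
   (18735537404109652480, [2,2,0,1,1]),
   (18735537404126429440, [2,2,1,0,1]),
   (18735537404143206400, [2,2,1,1,0])]

/-- Rows with letter counts (1, 3, 1), each with its packed pair counts. -/
def tab9 : List (ℕ × List ℕ) :=
  [(3311419851520, [0,1,1,1,2]),
   (72059805946151680, [0,1,1,2,1]),
   (144116300472451840, [0,1,2,1,1]),
   (216172794998752000, [0,2,1,1,1]),
   (3311436628480, [1,0,1,1,2]),
   (72059805962928640, [1,0,1,2,1]),
   (144116300489228800, [1,0,2,1,1]),
   (3311453405440, [1,1,0,1,2]),
   (72059805979705600, [1,1,0,2,1]),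
   (3311470182400, [1,1,1,0,2]),
   (284786446827520, [1,1,1,2,0]),
   (72341280956350720, [1,1,2,0,1]),
   (72341280973127680, [1,1,2,1,0]),
   (144397775465873920, [1,2,0,1,1]),
   (144397775482650880, [1,2,1,0,1]),
   (144397775499427840, [1,2,1,1,0]),
   (216454269975397120, [2,0,1,1,1]),
   (216454269992174080, [2,1,0,1,1]),
   (216454270008951040, [2,1,1,0,1]),
   (216454270025728000, [2,1,1,1,0])]

/-- Rows with letter counts (2, 0, 3), each with its packed pair counts. -/
def tab12 : List (ℕ × List ℕ) :=
  [(55340232221129048065, [0,0,2,2,2]),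
   (55340513696105693185, [0,2,0,2,2]),
   (55340795171082338305, [0,2,2,0,2]),
   (55341076646058983425, [0,2,2,2,0]),
   (55340795171082338305, [2,0,0,2,2]),
   (55341076646058983425, [2,0,2,0,2]),
   (55341358121035628545, [2,0,2,2,0]),
   (55341358121035628545, [2,2,0,0,2]),
   (55341639596012273665, [2,2,0,2,0]),
   (55341921070988918785, [2,2,2,0,0])]

/-- Rows with letter counts (2, 1, 2), each with its packed pair counts. -/
def tab13 : List (ℕ × List ℕ) :=
  [(18446746272733069825, [0,0,1,2,2]),
   (18518802767259369985, [0,0,2,1,2]),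
   (18590859261785670145, [0,0,2,2,1]),
   (18446746272749846785, [0,1,0,2,2]),
   (18447027747726491905, [0,1,2,0,2]),
   (18447309222703137025, [0,1,2,2,0]),
   (18519084242236015105, [0,2,0,1,2]),
   (18591140736762315265, [0,2,0,2,1]),
   (18519084242252792065, [0,2,1,0,2]),
   (18519365717229437185, [0,2,1,2,0]),
   (18591422211738960385, [0,2,2,0,1]),
   (18591422211755737345, [0,2,2,1,0]),
   (18446746272766623745, [1,0,0,2,2]),
   (18447027747743268865, [1,0,2,0,2]),
   (18447309222719913985, [1,0,2,2,0]),
   (18447309222719913985, [1,2,0,0,2]),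
   (18447590697696559105, [1,2,0,2,0]),
   (18447872172673204225, [1,2,2,0,0]),
   (18519365717212660225, [2,0,0,1,2]),
   (18591422211738960385, [2,0,0,2,1]),
   (18519365717229437185, [2,0,1,0,2]),
   (18519647192206082305, [2,0,1,2,0]),
   (18591703686715605505, [2,0,2,0,1]),
   (18591703686732382465, [2,0,2,1,0]),
   (18519365717246214145, [2,1,0,0,2]),
   (18519647192222859265, [2,1,0,2,0]),
   (18519928667199504385, [2,1,2,0,0]),
   (18591985161692250625, [2,2,0,0,1]),
   (18591985161709027585, [2,2,0,1,0]),
   (18591985161725804545, [2,2,1,0,0])]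

/-- Rows with letter counts (2, 2, 1), each with its packed pair counts. -/
def tab14 : List (ℕ × List ℕ) :=
  [(2203318354945, [0,0,1,1,2]),
   (72058697844655105, [0,0,1,2,1]),
   (144115192370955265, [0,0,2,1,1]),
   (2203335131905, [0,1,0,1,2]),
   (72058697861432065, [0,1,0,2,1]),
   (2203351908865, [0,1,1,0,2]),
   (283678328553985, [0,1,1,2,0]),
   (72340172838077185, [0,1,2,0,1]),
   (72340172854854145, [0,1,2,1,0]),
   (144396667347600385, [0,2,0,1,1]),
   (144396667364377345, [0,2,1,0,1]),
   (144396667381154305, [0,2,1,1,0]),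
   (2203351908865, [1,0,0,1,2]),
   (72058697878209025, [1,0,0,2,1]),
   (2203368685825, [1,0,1,0,2]),
   (283678345330945, [1,0,1,2,0]),
   (72340172854854145, [1,0,2,0,1]),
   (72340172871631105, [1,0,2,1,0]),
   (2203385462785, [1,1,0,0,2]),
   (283678362107905, [1,1,0,2,0]),
   (565153338753025, [1,1,2,0,0]),
   (72621647831499265, [1,2,0,0,1]),
   (72621647848276225, [1,2,0,1,0]),
   (72621647865053185, [1,2,1,0,0]),
   (144678142324245505, [2,0,0,1,1]),
   (144678142341022465, [2,0,1,0,1]),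
   (144678142357799425, [2,0,1,1,0]),
   (144678142357799425, [2,1,0,0,1]),
   (144678142374576385, [2,1,0,1,0]),
   (144678142391353345, [2,1,1,0,0])]

/-- Rows with letter counts (2, 3, 0), each with its packed pair counts. -/
def tab15 : List (ℕ × List ℕ) :=
  [(12884903425, [0,0,1,1,1]),
   (12901680385, [0,1,0,1,1]),
   (12918457345, [0,1,1,0,1]),
   (12935234305, [0,1,1,1,0]),
   (12918457345, [1,0,0,1,1]),
   (12935234305, [1,0,1,0,1]),
   (12952011265, [1,0,1,1,0]),
   (12952011265, [1,1,0,0,1]),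
   (12968788225, [1,1,0,1,0]),
   (12985565185, [1,1,1,0,0])]

/-- Rows with letter counts (3, 0, 2), each with its packed pair counts. -/
def tab18 : List (ℕ × List ℕ) :=
  [(18446744073709944835, [0,0,0,2,2]),
   (18447025548686589955, [0,0,2,0,2]),
   (18447307023663235075, [0,0,2,2,0]),
   (18447307023663235075, [0,2,0,0,2]),
   (18447588498639880195, [0,2,0,2,0]),
   (18447869973616525315, [0,2,2,0,0]),
   (18447588498639880195, [2,0,0,0,2]),
   (18447869973616525315, [2,0,0,2,0]),
   (18448151448593170435, [2,0,2,0,0]),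
   (18448432923569815555, [2,2,0,0,0])]

/-- Rows with letter counts (3, 1, 1), each with its packed pair counts. -/
def tab19 : List (ℕ × List ℕ) :=
  [(1099511825155, [0,0,0,1,2]),
   (72057594038125315, [0,0,0,2,1]),
   (1099528602115, [0,0,1,0,2]),
   (282574505247235, [0,0,1,2,0]),
   (72339069014770435, [0,0,2,0,1]),
   (72339069031547395, [0,0,2,1,0]),
   (1099545379075, [0,1,0,0,2]),
   (282574522024195, [0,1,0,2,0]),
   (564049498669315, [0,1,2,0,0]),
   (72620543991415555, [0,2,0,0,1]),
   (72620544008192515, [0,2,0,1,0]),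
   (72620544024969475, [0,2,1,0,0]),
   (1099562156035, [1,0,0,0,2]),
   (282574538801155, [1,0,0,2,0]),
   (564049515446275, [1,0,2,0,0]),
   (845524492091395, [1,2,0,0,0]),
   (72902018968060675, [2,0,0,0,1]),
   (72902018984837635, [2,0,0,1,0]),
   (72902019001614595, [2,0,1,0,0]),
   (72902019018391555, [2,1,0,0,0])]

/-- Rows with letter counts (3, 2, 0), each with its packed pair counts. -/
def tab20 : List (ℕ × List ℕ) :=
  [(4294968835, [0,0,0,1,1]),
   (4311745795, [0,0,1,0,1]),
   (4328522755, [0,0,1,1,0]),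
   (4328522755, [0,1,0,0,1]),
   (4345299715, [0,1,0,1,0]),
   (4362076675, [0,1,1,0,0]),
   (4345299715, [1,0,0,0,1]),
   (4362076675, [1,0,0,1,0]),
   (4378853635, [1,0,1,0,0]),
   (4395630595, [1,1,0,0,0])]

def tab (k : ℕ) : List (ℕ × List ℕ) :=
  bif Nat.beq k 2 then tab2 else
  bif Nat.beq k 3 then tab3 else
  bif Nat.beq k 7 then tab7 else
  bif Nat.beq k 8 then tab8 else
  bif Nat.beq k 9 then tab9 else
  bif Nat.beq k 12 then tab12 else
  bif Nat.beq k 13 then tab13 else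
  bif Nat.beq k 14 then tab14 else
  bif Nat.beq k 15 then tab15 else
  bif Nat.beq k 18 then tab18 else
  bif Nat.beq k 19 then tab19 else
  bif Nat.beq k 20 then tab20 else
  []

/-- Packed pair counts of a row. -/
def pk (w : Fin 5 → Fin 3) : ℕ :=
  er w 0 0 + 256 * er w 0 1 + 256 ^ 2 * er w 0 2 + 256 ^ 3 * er w 1 0 + 256 ^ 4 * er w 1 1 +
  256 ^ 5 * er w 1 2 + 256 ^ 6 * er w 2 0 + 256 ^ 7 * er w 2 1 + 256 ^ 8 * er w 2 2

/-- Packed upper bounds for the pair counts in terms of the letter counts. -/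
def fu' (a b c : ℕ) : ℕ :=
  a * (a - 1) / 2 + 256 * (a * b) + 256 ^ 2 * (a * c) + 256 ^ 3 * (a * b) +
  256 ^ 4 * (b * (b - 1) / 2) + 256 ^ 5 * (b * c) + 256 ^ 6 * (a * c) + 256 ^ 7 * (b * c) +
  256 ^ 8 * (c * (c - 1) / 2)

def fu (k : ℕ) : ℕ := fu' (k / 6) (k % 6) (5 - k / 6 - k % 6)

def ge9 (X : ℕ) : Bool :=
  Nat.ble 9 (X / 256 % 256) && (Nat.ble 9 (X / 256 ^ 2 % 256) && (Nat.ble 9 (X / 256 ^ 3 % 256) &&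
  (Nat.ble 9 (X / 256 ^ 5 % 256) && (Nat.ble 9 (X / 256 ^ 6 % 256) &&
  (Nat.ble 9 (X / 256 ^ 7 % 256))))))

/-- A list of entries avoids one of the three letters. -/
def avoids (l : List ℕ) : Bool :=
  l.all (fun a => !(Nat.beq a 0)) || (l.all (fun a => !(Nat.beq a 1)) ||
    l.all (fun a => !(Nat.beq a 2)))

def mids (l : List (List ℕ)) : Bool :=
  avoids (l.map fun r => r.getD 1 0) && (avoids (l.map fun r => r.getD 2 0) &&
    avoids (l.map fun r => r.getD 3 0))

def prs : List (ℕ × ℕ) :=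
  [(0,1),(0,2),(0,3),(0,4),(1,2),(1,3),(1,4),(2,3),(2,4),(3,4)]

/-- Do the rows contain the pattern? -/
def occurs (l : List (List ℕ)) (x y z w : ℕ) : Bool :=
  prs.any fun p => prs.any fun r =>
    Nat.beq ((l.getD p.1 []).getD r.1 0) x && (Nat.beq ((l.getD p.1 []).getD r.2 0) y &&
    (Nat.beq ((l.getD p.2 []).getD r.1 0) z && Nat.beq ((l.getD p.2 []).getD r.2 0) w))

def six (l : List (List ℕ)) : Bool :=
  occurs l 1 2 2 1 && (occurs l 2 0 0 2 && (occurs l 0 1 1 0 && (occurs l 1 2 1 1 &&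
    (occurs l 1 1 1 0 && occurs l 0 1 2 1))))

def search (s : ℕ × ℕ × ℕ × ℕ × ℕ) : Bool :=
  (tab s.1).all fun p0 =>
    !(ge9 (4 * p0.1 + (3 * fu s.2.1 + 2 * fu s.2.2.1 + fu s.2.2.2.1))) ||
  (tab s.2.1).all fun p1 =>
    !(ge9 (4 * p0.1 + 3 * p1.1 + (2 * fu s.2.2.1 + fu s.2.2.2.1)) &&
      ge9 (p1.1 + (2 * fu s.2.2.1 + 3 * fu s.2.2.2.1 + 4 * fu s.2.2.2.2))) ||
  (tab s.2.2.1).all fun p2 =>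
    !(ge9 (4 * p0.1 + 3 * p1.1 + 2 * p2.1 + fu s.2.2.2.1) &&
      (ge9 (p1.1 + 2 * p2.1 + (3 * fu s.2.2.2.1 + 4 * fu s.2.2.2.2)) &&
      mids [p0.2, p1.2, p2.2])) ||
  (tab s.2.2.2.1).all fun p3 =>
    !(ge9 (4 * p0.1 + 3 * p1.1 + 2 * p2.1 + p3.1) &&
      (ge9 (p1.1 + 2 * p2.1 + 3 * p3.1 + 4 * fu s.2.2.2.2) &&
      mids [p0.2, p1.2, p2.2, p3.2])) ||
  (tab s.2.2.2.2).all fun p4 =>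
    !(ge9 (p1.1 + 2 * p2.1 + 3 * p3.1 + 4 * p4.1) &&
      (mids [p0.2, p1.2, p2.2, p3.2, p4.2] && six [p0.2, p1.2, p2.2, p3.2, p4.2]))

theorem search_true : fin.all search = true := by decide +kernel

def usedCodes : List ℕ := [2, 3, 7, 8, 9, 12, 13, 14, 15, 18, 19, 20]

theorem tab_mem (w : Fin 5 → Fin 3) (h : code (comp w) ∈ usedCodes) :
    (pk w, rowL w) ∈ tab (code (comp w)) := by
  revert w; apply forall_row; decide +kernel

theorem fin_used (s) (h : s ∈ fin) : s.1 ∈ usedCodes ∧ s.2.1 ∈ usedCodes ∧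
    s.2.2.1 ∈ usedCodes ∧ s.2.2.2.1 ∈ usedCodes ∧ s.2.2.2.2 ∈ usedCodes := by
  revert s; decide +kernel

/-- The upper bound on pair counts. -/
def ub (w : Fin 5 → Fin 3) (x y : Fin 3) : ℕ :=
  if x = y then cr w x * (cr w x - 1) / 2 else cr w x * cr w y

theorem er_le_ub (w : Fin 5 → Fin 3) : ∀ x y : Fin 3, er w x y ≤ ub w x y := by
  revert w; apply forall_row; decide +kernel

theorem ub_le (w : Fin 5 → Fin 3) : ∀ x y : Fin 3, ub w x y ≤ 10 := by
  revert w; apply forall_row; decide +kernel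

/-- Packing of a 3 × 3 table. -/
def pack (g : Fin 3 → Fin 3 → ℕ) : ℕ :=
  g 0 0 + 256 * g 0 1 + 256 ^ 2 * g 0 2 + 256 ^ 3 * g 1 0 + 256 ^ 4 * g 1 1 +
  256 ^ 5 * g 1 2 + 256 ^ 6 * g 2 0 + 256 ^ 7 * g 2 1 + 256 ^ 8 * g 2 2

theorem pk_eq (w) : pk w = pack (fun x y => er w x y) := rfl

theorem fu_eq (w : Fin 5 → Fin 3) : fu (code (comp w)) = pack (ub w) := by
  revert w; apply forall_row; decide +kernel

theorem ge9_pack (g : Fin 3 → Fin 3 → ℕ) (h : ∀ x y, 9 ≤ g x y) (h' : ∀ x y, g x y < 256) :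
    ge9 (pack g) = true := by
  have a1 := h 0 1
  have a2 := h 0 2
  have a3 := h 1 0
  have a5 := h 1 2
  have a6 := h 2 0
  have a7 := h 2 1
  have b0 := h' 0 0
  have b1 := h' 0 1
  have b2 := h' 0 2
  have b3 := h' 1 0
  have b4 := h' 1 1
  have b5 := h' 1 2
  have b6 := h' 2 0
  have b7 := h' 2 1
  simp only [ge9, pack, Bool.and_eq_true, Nat.ble_eq]
  generalize g 0 0 = g0 at *
  generalize g 0 1 = g1 at *
  generalize g 0 2 = g2 at *
  generalize g 1 0 = g3 at *
  generalize g 1 1 = g4 at *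
  generalize g 1 2 = g5 at *
  generalize g 2 0 = g6 at *
  generalize g 2 1 = g7 at *
  generalize g 2 2 = g8 at *
  refine ⟨?_, ?_, ?_, ?_, ?_, ?_⟩ <;> omega

/-- General form of the weighted test. -/
theorem ge9_lin (g0 g1 g2 g3 : Fin 3 → Fin 3 → ℕ) (X : ℕ)
    (hX : X = 4 * pack g0 + 3 * pack g1 + 2 * pack g2 + pack g3)
    (h : ∀ x y, 9 ≤ 4 * g0 x y + 3 * g1 x y + 2 * g2 x y + g3 x y)
    (b0 : ∀ x y, g0 x y ≤ 10) (b1 : ∀ x y, g1 x y ≤ 10) (b2 : ∀ x y, g2 x y ≤ 10)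
    (b3 : ∀ x y, g3 x y ≤ 10) : ge9 X = true := by
  have : X = pack (fun x y => 4 * g0 x y + 3 * g1 x y + 2 * g2 x y + g3 x y) := by
    rw [hX]; simp only [pack]; ring
  rw [this]
  apply ge9_pack _ h
  intro x y
  have := b0 x y
  have := b1 x y
  have := b2 x y
  have := b3 x y
  omega

theorem fin_mid (s) (h : s ∈ fin) : (∀ k, (k = s.2.1 ∨ k = s.2.2.1 ∨ k = s.2.2.2.1) →
    k ∈ [2, 3, 12, 15, 18, 20]) := by
  have : ∀ s ∈ fin, s.2.1 ∈ [2, 3, 12, 15, 18, 20] ∧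
      s.2.2.1 ∈ [2, 3, 12, 15, 18, 20] ∧
      s.2.2.2.1 ∈ [2, 3, 12, 15, 18, 20] := by decide +kernel
  obtain ⟨h1, h2, h3⟩ := this s h
  rintro k (rfl | rfl | rfl) <;> assumption

theorem avoid_of (w : Fin 5 → Fin 3) (h : code (comp w) ∈ [2, 3, 12, 15, 18, 20]) :
    avoids [w 0, w 1, w 2] = true ∧ avoids [w 0, w 1, w 2, w 3] = true ∧
    avoids [w 0, w 1, w 2, w 3, w 4] = true := by
  revert w; apply forall_row; decide +kernel

theorem occurs_of {M} (h : Has M) (x y z w : Fin 3) :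
    occurs [rowL (M 0), rowL (M 1), rowL (M 2), rowL (M 3), rowL (M 4)] x y z w = true := by
  obtain ⟨i, j, c, d, h1, h2, h3, h4, h5, h6⟩ := h x y z w
  have hp : ∀ i j : Fin 5, i < j → ((i : ℕ), (j : ℕ)) ∈ prs := by decide
  have hg : ∀ i c : Fin 5, (([rowL (M 0), rowL (M 1), rowL (M 2), rowL (M 3),
      rowL (M 4)] : List (List ℕ)).getD i []).getD c 0 = M i c := by
    intro i c; fin_cases i <;> fin_cases c <;> rfl
  rw [occurs, List.any_eq_true]
  refine ⟨_, hp i j h1, ?_⟩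
  rw [List.any_eq_true]
  refine ⟨_, hp c d h2, ?_⟩
  simp only [hg, h3, h4, h5, h6]
  simp

theorem not_has {M} (h : Has M) : False := by
  have hm := codes_mem h
  have hc := codes_mem h.transpose
  obtain ⟨u0, u1, u2, u3, u4⟩ := fin_used _ hm
  have ht := top h
  have hb := bot h
  have e0 := er_le_ub (M 0)
  have e1 := er_le_ub (M 1)
  have e2 := er_le_ub (M 2)
  have e3 := er_le_ub (M 3)
  have e4 := er_le_ub (M 4)
  have v0 := ub_le (M 0)
  have v1 := ub_le (M 1)
  have v2 := ub_le (M 2)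
  have v3 := ub_le (M 3)
  have v4 := ub_le (M 4)
  have x0 := fun x y => (e0 x y).trans (v0 x y)
  have x1 := fun x y => (e1 x y).trans (v1 x y)
  have x2 := fun x y => (e2 x y).trans (v2 x y)
  have x3 := fun x y => (e3 x y).trans (v3 x y)
  have x4 := fun x y => (e4 x y).trans (v4 x y)
  obtain ⟨c13, c14, c15⟩ := avoid_of _ (fin_mid _ hc _ (Or.inl rfl))
  obtain ⟨c23, c24, c25⟩ := avoid_of _ (fin_mid _ hc _ (Or.inr (Or.inl rfl)))
  obtain ⟨c33, c34, c35⟩ := avoid_of _ (fin_mid _ hc _ (Or.inr (Or.inr rfl)))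
  have key := List.all_eq_true.1 search_true _ hm
  simp only [search, codes] at key
  have T0 : ge9 (4 * pk (M 0) + (3 * fu (code (comp (M 1))) + 2 * fu (code (comp (M 2))) +
      fu (code (comp (M 3))))) = true := by
    refine ge9_lin (fun x y => er (M 0) x y) (ub (M 1)) (ub (M 2)) (ub (M 3)) _ ?_ ?_ x0 v1 v2 v3
    · rw [fu_eq, fu_eq, fu_eq, pk_eq]; ring
    · intro x y
      have := ht x y; have := e1 x y; have := e2 x y; have := e3 x y; omega
  have T1 : ge9 (4 * pk (M 0) + 3 * pk (M 1) + (2 * fu (code (comp (M 2))) +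
      fu (code (comp (M 3))))) = true := by
    refine ge9_lin (fun x y => er (M 0) x y) (fun x y => er (M 1) x y) (ub (M 2)) (ub (M 3)) _
      ?_ ?_ x0 x1 v2 v3
    · rw [fu_eq, fu_eq, pk_eq, pk_eq]; ring
    · intro x y
      have := ht x y; have := e2 x y; have := e3 x y; omega
  have T2 : ge9 (4 * pk (M 0) + 3 * pk (M 1) + 2 * pk (M 2) + fu (code (comp (M 3)))) = true := by
    refine ge9_lin (fun x y => er (M 0) x y) (fun x y => er (M 1) x y) (fun x y => er (M 2) x y)
      (ub (M 3)) _ ?_ ?_ x0 x1 x2 v3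
    · rw [fu_eq, pk_eq, pk_eq, pk_eq]
    · intro x y
      have := ht x y; have := e3 x y; omega
  have T3 : ge9 (4 * pk (M 0) + 3 * pk (M 1) + 2 * pk (M 2) + pk (M 3)) = true :=
    ge9_lin (fun x y => er (M 0) x y) (fun x y => er (M 1) x y) (fun x y => er (M 2) x y)
      (fun x y => er (M 3) x y) _ rfl ht x0 x1 x2 x3
  have B1 : ge9 (pk (M 1) + (2 * fu (code (comp (M 2))) + 3 * fu (code (comp (M 3))) +
      4 * fu (code (comp (M 4))))) = true := by
    refine ge9_lin (ub (M 4)) (ub (M 3)) (ub (M 2)) (fun x y => er (M 1) x y) _ ?_ ?_ v4 v3 v2 x1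
    · rw [fu_eq, fu_eq, fu_eq, pk_eq]; ring
    · intro x y
      have := hb x y; have := e4 x y; have := e2 x y; have := e3 x y; omega
  have B2 : ge9 (pk (M 1) + 2 * pk (M 2) + (3 * fu (code (comp (M 3))) +
      4 * fu (code (comp (M 4))))) = true := by
    refine ge9_lin (ub (M 4)) (ub (M 3)) (fun x y => er (M 2) x y) (fun x y => er (M 1) x y) _
      ?_ ?_ v4 v3 x2 x1
    · rw [fu_eq, fu_eq, pk_eq, pk_eq]; ring
    · intro x y
      have := hb x y; have := e4 x y; have := e3 x y; omega
  have B3 : ge9 (pk (M 1) + 2 * pk (M 2) + 3 * pk (M 3) + 4 * fu (code (comp (M 4)))) = true := by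
    refine ge9_lin (ub (M 4)) (fun x y => er (M 3) x y) (fun x y => er (M 2) x y)
      (fun x y => er (M 1) x y) _ ?_ ?_ v4 x3 x2 x1
    · rw [fu_eq, pk_eq, pk_eq, pk_eq]; ring
    · intro x y
      have := hb x y; have := e4 x y; omega
  have B4 : ge9 (pk (M 1) + 2 * pk (M 2) + 3 * pk (M 3) + 4 * pk (M 4)) = true := by
    refine ge9_lin (fun x y => er (M 4) x y) (fun x y => er (M 3) x y) (fun x y => er (M 2) x y)
      (fun x y => er (M 1) x y) _ ?_ ?_ x4 x3 x2 x1
    · simp only [pk_eq]; ring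
    · intro x y
      have := hb x y; omega
  have M3 : mids [rowL (M 0), rowL (M 1), rowL (M 2)] = true := by
    rw [mids, Bool.and_eq_true, Bool.and_eq_true]; exact ⟨c13, c23, c33⟩
  have M4 : mids [rowL (M 0), rowL (M 1), rowL (M 2), rowL (M 3)] = true := by
    rw [mids, Bool.and_eq_true, Bool.and_eq_true]; exact ⟨c14, c24, c34⟩
  have M5 : mids [rowL (M 0), rowL (M 1), rowL (M 2), rowL (M 3), rowL (M 4)] = true := by
    rw [mids, Bool.and_eq_true, Bool.and_eq_true]; exact ⟨c15, c25, c35⟩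
  have S6 : six [rowL (M 0), rowL (M 1), rowL (M 2), rowL (M 3), rowL (M 4)] = true := by
    simp only [six, Bool.and_eq_true]
    exact ⟨occurs_of h 1 2 2 1, occurs_of h 2 0 0 2, occurs_of h 0 1 1 0, occurs_of h 1 2 1 1,
      occurs_of h 1 1 1 0, occurs_of h 0 1 2 1⟩
  have key := List.all_eq_true.1 key _ (tab_mem _ u0)
  simp only [T0, Bool.not_true, Bool.false_or] at key
  have key := List.all_eq_true.1 key _ (tab_mem _ u1)
  simp only [T1, B1, Bool.and_true, Bool.not_true, Bool.false_or] at key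
  have key := List.all_eq_true.1 key _ (tab_mem _ u2)
  simp only [T2, B2, M3, Bool.and_true, Bool.not_true, Bool.false_or] at key
  have key := List.all_eq_true.1 key _ (tab_mem _ u3)
  simp only [T3, B3, M4, Bool.and_true, Bool.not_true, Bool.false_or] at key
  have key := List.all_eq_true.1 key _ (tab_mem _ u4)
  simp only [B4, M5, S6, Bool.and_true, Bool.not_true] at key
  exact absurd key (by decide)

/-! ### The upper bound -/

def M6 : Fin 6 → Fin 6 → Fin 3 :=
  ![![1, 2, 1, 2, 0, 1], ![0, 0, 1, 0, 2, 0], ![2, 2, 2, 1, 0, 0],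
    ![1, 2, 0, 2, 2, 1], ![0, 1, 1, 0, 1, 2], ![0, 2, 0, 0, 1, 2]]

theorem M6_has : ∀ x y z w : Fin 3, ∃ i j : Fin 6, i < j ∧ ∃ c : Fin 6, M6 i c = x ∧ M6 j c = z ∧
    ∃ d : Fin 6, c < d ∧ M6 i d = y ∧ M6 j d = w := by
  decide +kernel

theorem strictMono_pair {n : ℕ} {i j : Fin n} (h : i < j) : StrictMono ![i, j] := by
  intro a b hab
  fin_cases a <;> fin_cases b <;> simp_all

theorem upper : IsOmnimosaic 3 2 M6 := by
  intro T
  obtain ⟨i, j, hij, c, h1, h2, d, hcd, h3, h4⟩ := M6_has (T 0 0) (T 0 1) (T 1 0) (T 1 1)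
  refine ⟨![i, j], ![c, d], strictMono_pair hij, strictMono_pair hcd, ?_⟩
  intro a b
  fin_cases a <;> fin_cases b <;> simp [h1, h2, h3, h4]

theorem lower {n : ℕ} (hn : n ≤ 5) (M : Fin n → Fin n → Fin 3) (h : IsOmnimosaic 3 2 M) :
    False := by
  let N : Fin 5 → Fin 5 → Fin 3 := fun i j =>
    if h : (i : ℕ) < n ∧ (j : ℕ) < n then M ⟨i, h.1⟩ ⟨j, h.2⟩ else 0
  have hN : ∀ i j : Fin n, N (Fin.castLE hn i) (Fin.castLE hn j) = M i j := by
    intro i j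
    simp [N]
  apply not_has (M := N)
  intro x y z w
  obtain ⟨ρ, σ, hρ, hσ, hT⟩ := h ![![x, y], ![z, w]]
  refine ⟨Fin.castLE hn (ρ 0), Fin.castLE hn (ρ 1), Fin.castLE hn (σ 0), Fin.castLE hn (σ 1),
    ?_, ?_, ?_⟩
  · exact hρ (by decide : (0 : Fin 2) < 1)
  · exact hσ (by decide : (0 : Fin 2) < 1)
  · simp only [hN, ← hT]
    simp

end Omni

theorem omega_two_three_eq_six :
    (∃ M : Fin 6 → Fin 6 → Fin 3, IsOmnimosaic 3 2 M) ∧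
    (∀ n : ℕ, n ≤ 5 → ¬ ∃ M : Fin n → Fin n → Fin 3, IsOmnimosaic 3 2 M) := by
  refine ⟨⟨Omni.M6, Omni.upper⟩, ?_⟩
  rintro n hn ⟨M, hM⟩
  exact Omni.lower hn M hM
end

section
/- For all integers k ≥ 1 and a ≥ 2, ω(k,a) ≤ ⌈k/2⌉ · a^⌈k/2⌉ + ⌊k/2⌋ · a^⌊k/2⌋; that is, there exists an n×n matrix over an a-letter alphabet with n = ⌈k/2⌉·a^⌈k/2⌉ + ⌊k/2⌋·a^⌊k/2⌋ that contains every k×k matrix over that alphabet as a submatrix. -/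
/-- Decoding: consecutive blocks of lengths `a ^ c i`, block `i` listing all words of length `c i`. -/
lemma exists_decode (a : ℕ) (ha : 0 < a) (c : ℕ → ℕ) (m : ℕ) :
    ∃ (B : ℕ → ℕ) (W : ℕ → ℕ → Fin a), Monotone B ∧ (∀ x, B x ≤ m) ∧
      ∀ i < m, ∀ w : ℕ → Fin a, ∃ x < ∑ i ∈ Finset.range m, a ^ c i,
        B x = i ∧ ∀ e < c i, W x e = w e := by
  induction m with
  | zero => exact ⟨fun _ => 0, fun _ _ => ⟨0, ha⟩, fun _ _ _ => le_rfl, by simp, by simp⟩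
  | succ m ih =>
    obtain ⟨B, W, hB, hm, h⟩ := ih
    rw [Finset.sum_range_succ]
    set S := ∑ i ∈ Finset.range m, a ^ c i with hS
    refine ⟨fun x => if x < S then B x else m,
      fun x e => if x < S then W x e else
        if hx : x - S < a ^ c m ∧ e < c m then
          finFunctionFinEquiv.symm ⟨x - S, hx.1⟩ ⟨e, hx.2⟩ else ⟨0, ha⟩, ?_, ?_, ?_⟩
    · intro x y hxy
      dsimp only
      split_ifs with h1 h2
      · exact hB hxy
      · exact hm x
      · omega
      · exact le_rfl
    · intro x
      have := hm x
      dsimp only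
      split_ifs <;> omega
    · intro i hi w
      rcases Nat.lt_succ_iff_lt_or_eq.mp hi with hi | rfl
      · obtain ⟨x, hx, h1, h2⟩ := h i hi w
        refine ⟨x, by omega, by simp [hx, h1], fun e he => by simp [hx, h2 e he]⟩
      · let r : Fin (a ^ c i) := finFunctionFinEquiv (fun e : Fin (c i) => w e)
        have hr := r.isLt
        refine ⟨S + r, by omega, by simp, fun e he => ?_⟩
        have : ¬ (S + (r : ℕ) < S) := by omega
        simp only [this, if_false, Nat.add_sub_cancel_left, hr, he, and_self, dif_pos, Fin.eta]
        simp [r]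

theorem construction_upper_bound (k a : ℕ) (hk : 1 ≤ k) (ha : 2 ≤ a) :
    ∃ M : Fin ((k + 1) / 2 * a ^ ((k + 1) / 2) + k / 2 * a ^ (k / 2)) →
        Fin ((k + 1) / 2 * a ^ ((k + 1) / 2) + k / 2 * a ^ (k / 2)) → Fin a,
      IsOmnimosaic a k M := by
  let c : ℕ → ℕ := fun i => if i < (k + 1) / 2 then (k + 1) / 2 else k / 2
  have hsum : ∑ i ∈ Finset.range k, a ^ c i =
      (k + 1) / 2 * a ^ ((k + 1) / 2) + k / 2 * a ^ (k / 2) := by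
    have hk2 : k = (k + 1) / 2 + k / 2 := by omega
    conv_lhs => rw [hk2]
    rw [Finset.sum_range_add]
    congr 1
    · rw [Finset.sum_congr rfl (g := fun _ => a ^ ((k + 1) / 2))]
      · simp
      · intro i hi
        simp [c, Finset.mem_range.mp hi]
    · simp [c]
  rw [← hsum]
  obtain ⟨B, W, hB, -, h⟩ := exists_decode a (by omega) c k
  -- cyclic distance from `i` to `j`
  let d : ℕ → ℕ → ℕ := fun i j => if i ≤ j then j - i else j + k - i
  refine ⟨fun x y => if d (B x) (B y) < c (B x) then W x (d (B x) (B y))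
    else W y (k - 1 - d (B x) (B y)), fun T => ?_⟩
  have hrow : ∀ i : Fin k, ∃ x < ∑ i ∈ Finset.range k, a ^ c i, B x = i ∧ ∀ e < c i,
      W x e = T i ⟨(i + e) % k, Nat.mod_lt _ hk⟩ := fun i =>
    h i i.2 (fun e => T i ⟨(i + e) % k, Nat.mod_lt _ hk⟩)
  have hcol : ∀ j : Fin k, ∃ x < ∑ i ∈ Finset.range k, a ^ c i, B x = j ∧ ∀ e < c j,
      W x e = T ⟨(j + e + 1) % k, Nat.mod_lt _ hk⟩ j := fun j =>
    h j j.2 (fun e => T ⟨(j + e + 1) % k, Nat.mod_lt _ hk⟩ j)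
  choose r hr hr1 hr2 using hrow
  choose s hs hs1 hs2 using hcol
  refine ⟨fun i => ⟨r i, hr i⟩, fun j => ⟨s j, hs j⟩, ?_, ?_, ?_⟩
  · intro i j hij
    refine hB.reflect_lt (?_ : B (r i) < B (r j))
    rw [hr1, hr1]; exact hij
  · intro i j hij
    refine hB.reflect_lt (?_ : B (s i) < B (s j))
    rw [hs1, hs1]; exact hij
  · intro i j
    have hi := i.2
    have hj := j.2
    simp only [hr1, hs1]
    split_ifs with hd
    · rw [hr2 i _ hd]
      congr 1
      apply Fin.ext
      simp only [d]
      split_ifs with hij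
      · rw [show (i : ℕ) + (j - i) = j by omega, Nat.mod_eq_of_lt hj]
      · rw [show (i : ℕ) + (j + k - i) = j + k by omega, Nat.add_mod_right, Nat.mod_eq_of_lt hj]
    · have he : k - 1 - d i j < c j := by
        simp only [d, c] at hd ⊢
        split_ifs at hd ⊢ <;> omega
      rw [hs2 j _ he]
      congr 1
      apply Fin.ext
      simp only [d]
      split_ifs with hij
      · rw [show (j : ℕ) + (k - 1 - (j - i)) + 1 = i + k by omega, Nat.add_mod_right,
          Nat.mod_eq_of_lt hi]
      · rw [show (j : ℕ) + (k - 1 - (j + k - i)) + 1 = i by omega, Nat.mod_eq_of_lt hi]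
end

section
/- For every integer k ≥ 1 there exists a function B : Fin k → Fin k → Bool (interpreting B i j = true as a horizontal line and B i j = false as a vertical line in cell (i,j) of a k×k grid) such that, writing r_i = #{ j : B i j = true } and c_j = #{ i : B i j = false }, exactly ⌊k/2⌋ of the r_i equal ⌈k/2⌉ while the remaining ⌈k/2⌉ of the r_i equal ⌊k/2⌋, and exactly ⌈k/2⌉ of the c_j equal ⌈k/2⌉ while the remaining ⌊k/2⌋ of the c_j equal ⌊k/2⌋. -/
/-- Number of `j : Fin k` with `a + j` odd. -/
theorem card_odd_shift (k : ℕ) : ∀ a : ℕ,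
    (Finset.univ.filter fun j : Fin k => (a + j.val) % 2 = 1).card = (k + a % 2) / 2 := by
  induction k with
  | zero => intro a; simp; try omega
  | succ n ih =>
    intro a
    rw [Fin.card_filter_univ_succ]
    have h := ih (a + 1)
    have e : (Finset.univ.filter ((fun j : Fin (n+1) => (a + j.val) % 2 = 1) ∘ Fin.succ)).card
        = (n + (a + 1) % 2) / 2 := by
      rw [← h]
      congr 1
      ext j
      simp only [Finset.mem_filter, Finset.mem_univ, true_and, Function.comp, Fin.val_succ]
      omega
    simp only [Function.comp_def] at e ⊢
    rw [e]
    have hz : ((0 : Fin (n+1)) : ℕ) = 0 := rfl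
    by_cases h1 : (a + ((0 : Fin (n+1)) : ℕ)) % 2 = 1
    · rw [if_pos h1]; omega
    · rw [if_neg h1]; omega

theorem grid_existence (k : ℕ) (hk : 1 ≤ k) :
    ∃ B : Fin k → Fin k → Bool,
      (∃ S : Finset (Fin k), S.card = k / 2 ∧
        (∀ i ∈ S, (Finset.univ.filter fun j => B i j = true).card = (k + 1) / 2) ∧
        (∀ i ∉ S, (Finset.univ.filter fun j => B i j = true).card = k / 2)) ∧
      (∃ T : Finset (Fin k), T.card = (k + 1) / 2 ∧
        (∀ j ∈ T, (Finset.univ.filter fun i => B i j = false).card = (k + 1) / 2) ∧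
        (∀ j ∉ T, (Finset.univ.filter fun i => B i j = false).card = k / 2)) := by
  have hr : ∀ i : Fin k, (Finset.univ.filter fun j : Fin k =>
      decide ((i.val + j.val) % 2 = 1) = true).card = (k + i.val % 2) / 2 := by
    intro i
    rw [← card_odd_shift]
    congr 1
    ext j
    simp
  have hc : ∀ j : Fin k, (Finset.univ.filter fun i : Fin k =>
      decide ((i.val + j.val) % 2 = 1) = false).card = (k + (j.val + 1) % 2) / 2 := by
    intro j
    rw [← card_odd_shift]
    congr 1
    ext i
    simp only [Finset.mem_filter, Finset.mem_univ, true_and, decide_eq_false_iff_not]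
    omega
  refine ⟨fun i j => decide ((i.val + j.val) % 2 = 1),
    ⟨Finset.univ.filter fun i => (0 + i.val) % 2 = 1, card_odd_shift k 0, ?_, ?_⟩,
    ⟨Finset.univ.filter fun j => (1 + j.val) % 2 = 1, card_odd_shift k 1, ?_, ?_⟩⟩
  all_goals
    intro i hi
    simp only [Finset.mem_filter, Finset.mem_univ, true_and] at hi
    first
      | rw [hr]
      | rw [hc]
    congr 1
    omega
end

section
/- Let k ≥ 1, a ≥ 2 be integers and let B : Fin k → Fin k → Bool be any placement of horizontal and vertical lines in a k×k grid, with r_i = #{ j : B i j = true } and c_j = #{ i : B i j = false }. Then there exists a rectangular omnimosaic for parameters (k,a) with m = Σ_{i} a^{r_i} rows and n = Σ_{j} a^{c_j} columns, i.e. an m×n matrix over the alphabet {1,…,a} containing every k×k matrix over that alphabet as a submatrix. -/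
theorem sigma_strictMono_aux {k : ℕ} (n : Fin k → ℕ) (p : ∀ i, Fin (n i)) :
    StrictMono (fun i => (finSigmaFinEquiv ⟨i, p i⟩ : Fin (∑ i, n i))) := by
  cases k with
  | zero => intro i; exact i.elim0
  | succ k =>
    rw [Fin.strictMono_iff_lt_succ]
    intro i
    rw [Fin.lt_def, finSigmaFinEquiv_apply, finSigmaFinEquiv_apply]
    have h : ∑ x : Fin (i.succ : Fin (k+1)).val, n (Fin.castLE i.succ.2.le x)
        = ∑ x : Fin (i.castSucc : Fin (k+1)).val, n (Fin.castLE i.castSucc.2.le x)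
          + n i.castSucc := by
      exact Fin.sum_univ_castSucc (n := i.val) (fun x => n (Fin.castLE i.succ.2.le x))
    have := (p i.castSucc).2
    dsimp only at h ⊢
    omega

theorem rect_omnimosaic_from_grid (k a : ℕ) (hk : 1 ≤ k) (ha : 2 ≤ a)
    (B : Fin k → Fin k → Bool) :
    ∃ M : Fin (∑ i : Fin k, a ^ (Finset.univ.filter fun j => B i j = true).card) →
        Fin (∑ j : Fin k, a ^ (Finset.univ.filter fun i => B i j = false).card) → Fin a,
      IsOmnimosaic a k M := by
  have E : ∀ i, ({j // B i j = true} → Fin a) ≃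
      Fin (a ^ (Finset.univ.filter fun j => B i j = true).card) := fun i =>
    Fintype.equivFinOfCardEq (by simp [Fintype.card_subtype])
  have F : ∀ j, ({i // B i j = false} → Fin a) ≃
      Fin (a ^ (Finset.univ.filter fun i => B i j = false).card) := fun j =>
    Fintype.equivFinOfCardEq (by simp [Fintype.card_subtype])
  let G : (Σ i : Fin k, Fin (a ^ (Finset.univ.filter fun j => B i j = true).card)) →
      (Σ j : Fin k, Fin (a ^ (Finset.univ.filter fun i => B i j = false).card)) → Fin a :=
    fun x y => if h : B x.1 y.1 = true then (E x.1).symm x.2 ⟨y.1, h⟩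
      else (F y.1).symm y.2 ⟨x.1, by simpa using h⟩
  refine ⟨fun x y => G (finSigmaFinEquiv.symm x) (finSigmaFinEquiv.symm y), ?_⟩
  intro T
  refine ⟨_, _, sigma_strictMono_aux _ (fun i => E i (fun j => T i j.1)),
    sigma_strictMono_aux _ (fun j => F j (fun i => T i.1 j)), ?_⟩
  intro i j
  simp only [Equiv.symm_apply_apply, G]
  split <;> rfl
end

section
/- For all integers k ≥ 1 and a ≥ 2 there exists an m×k rectangular omnimosaic for parameters (k,a) with m = k·a^k rows; that is, a (k·a^k)×k matrix over the alphabet {1,…,a} containing every k×k matrix over that alphabet as a submatrix. -/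
theorem thin_strip_exists (k a : ℕ) (hk : 1 ≤ k) (ha : 2 ≤ a) :
    ∃ M : Fin (k * a ^ k) → Fin k → Fin a, IsOmnimosaic a k M := by
  refine ⟨fun r => finFunctionFinEquiv.symm (finProdFinEquiv.symm r).2, ?_⟩
  intro T
  refine ⟨fun i => finProdFinEquiv (i, finFunctionFinEquiv (T i)), id, ?_, strictMono_id, ?_⟩
  · intro i j hij
    rw [Fin.lt_def] at hij ⊢
    simp only [finProdFinEquiv_apply_val]
    have h1 := (finFunctionFinEquiv (T i)).isLt
    have h2 : a ^ k * (i.val + 1) ≤ a ^ k * j.val := Nat.mul_le_mul_left _ hij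
    rw [Nat.mul_add, Nat.mul_one] at h2
    omega
  · intro i j
    simp only [Equiv.symm_apply_apply, id]
end

section
/- For all integers k ≥ 1 and a ≥ 2, any m×k rectangular omnimosaic for parameters (k,a) (an m×k matrix over the alphabet {1,…,a} containing every k×k matrix over that alphabet as a submatrix) satisfies m ≥ k·a^k; in other words, the thin strip omnimosaic of dimension (k·a^k)×k is the smallest possible array with k columns. -/
theorem thin_strip_optimal (k a m : ℕ) (hk : 1 ≤ k) (ha : 2 ≤ a)
    (M : Fin m → Fin k → Fin a) (h : IsOmnimosaic a k M) :
    m ≥ k * a ^ k := by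
  choose ρ σ hρ hσ hM using fun w : Fin k → Fin a => h (fun _ => w)
  have hid : ∀ w, σ w = id := fun w =>
    (StrictMono.range_inj (hσ w) strictMono_id).mp (by
      rw [(Finite.injective_iff_surjective.mp (hσ w).injective).range_eq,
        Function.surjective_id.range_eq])
  have hrow : ∀ w i, M (ρ w i) = w := by
    intro w i
    funext j
    have := hM w i j
    rw [hid w] at this
    exact this.symm
  have hinj : Function.Injective
      (fun p : Fin k × (Fin k → Fin a) => ρ p.2 p.1) := by
    rintro ⟨i, w⟩ ⟨j, v⟩ hp
    have hp' : ρ w i = ρ v j := hp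
    have hwv : w = v := by rw [← hrow w i, hp', hrow v j]
    subst hwv
    rw [(hρ w).injective hp']
  simpa using Fintype.card_le_of_injective _ hinj
end

section
/- For every fixed integer a ≥ 2 there exists K such that for all integers k ≥ K, ω(k,a) ≤ (k · a^(k/2) / e) · (1 + 2·log k / k); that is, for every integer n with (n : ℝ) ≥ (k · a^(k/2) / e)(1 + 2 log k / k) there exists an n×n matrix over an a-letter alphabet containing every k×k matrix over that alphabet as a submatrix. Here a^(k/2) denotes the real power, log is the natural logarithm, and e is Euler's number. -/
open Classical in
/-- Number of points of a finite type satisfying a predicate, as a real number. -/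
noncomputable def cnt {Ω : Type*} [Fintype Ω] (P : Ω → Prop) : ℝ :=
  ((Finset.univ.filter P).card : ℝ)

theorem cnt_nonneg {Ω : Type*} [Fintype Ω] (P : Ω → Prop) : 0 ≤ cnt P := by
  unfold cnt; positivity

theorem cnt_mono {Ω : Type*} [Fintype Ω] {P Q : Ω → Prop} (h : ∀ w, P w → Q w) :
    cnt P ≤ cnt Q := by
  classical
  unfold cnt
  exact_mod_cast Finset.card_le_card (fun w hw => by
    simp only [Finset.mem_filter, Finset.mem_univ, true_and] at hw ⊢
    exact h w hw)

theorem cnt_split {Ω : Type*} [Fintype Ω] (P Q : Ω → Prop) :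
    cnt P = cnt (fun w => Q w ∧ P w) + cnt (fun w => ¬ Q w ∧ P w) := by
  classical
  unfold cnt
  rw [← Finset.card_filter_add_card_filter_not (s := Finset.univ.filter P) Q]
  push_cast
  simp only [Finset.filter_filter, and_comm]

theorem cnt_union {Ω ι : Type*} [Fintype Ω] (P Q : Ω → Prop) (s : Finset ι) (B : ι → Ω → Prop)
    (h : ∀ w, P w → Q w ∨ ∃ j ∈ s, B j w) : cnt P ≤ cnt Q + ∑ j ∈ s, cnt (B j) := by
  classical
  unfold cnt
  have h1 : Finset.univ.filter P ⊆ Finset.univ.filter Q ∪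
      s.biUnion (fun j => Finset.univ.filter (B j)) := by
    intro w hw
    have := h w (by simpa using hw)
    simpa using this
  have h2 := (Finset.card_le_card h1).trans (Finset.card_union_le _ _)
  have h3 := h2.trans (Nat.add_le_add_left Finset.card_biUnion_le _)
  exact_mod_cast h3

/-- The event that no `A j`, `j ∈ S`, happens. -/
def av {Ω ι : Type*} (A : ι → Ω → Prop) (S : Finset ι) (w : Ω) : Prop := ∀ j ∈ S, ¬ A j w

theorem half_step {Ω ι : Type*} [Fintype Ω] [DecidableEq ι] (A : ι → Ω → Prop) (D S : Finset ι)
    (p : ℝ) (h3 : (D.card : ℝ) * p ≤ 1 / 4)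
    (h : ∀ j ∈ D, cnt (fun w => A j w ∧ av A (S \ D) w) ≤ 2 * p * cnt (av A (S \ D))) :
    cnt (av A (S \ D)) ≤ 2 * cnt (av A S) := by
  have h1 := cnt_union (av A (S \ D)) (av A S) D (fun j w => A j w ∧ av A (S \ D) w) (by
    intro w hw
    by_cases hS : av A S w
    · exact Or.inl hS
    · right
      unfold av at hS
      push Not at hS
      obtain ⟨j, hj, hA⟩ := hS
      refine ⟨j, ?_, hA, hw⟩
      by_contra hD
      exact hw j (by simp [hj, hD]) hA)
  have h2 := Finset.sum_le_sum h
  rw [Finset.sum_const, nsmul_eq_mul] at h2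
  have h4 := mul_le_mul_of_nonneg_right h3 (cnt_nonneg (av A (S \ D)))
  nlinarith

theorem lll {Ω ι : Type*} [Fintype Ω] [DecidableEq ι] (A : ι → Ω → Prop)
    (N : ι → Finset ι) (p : ℝ) (hp : 0 ≤ p)
    (h1 : ∀ i S, i ∉ S → Disjoint S (N i) →
      cnt (fun w => A i w ∧ av A S w) = p * cnt (av A S))
    (h3 : ∀ i, ((N i).card : ℝ) * p ≤ 1 / 4) :
    ∀ S : Finset ι, ∀ i, cnt (fun w => A i w ∧ av A S w) ≤ 2 * p * cnt (av A S) := by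
  intro S
  induction S using Finset.strongInduction with
  | H S ih =>
    intro i
    by_cases hi : i ∈ S
    · have : cnt (fun w => A i w ∧ av A S w) ≤ cnt (fun _ : Ω => False) :=
        cnt_mono (fun w hw => hw.2 i hi hw.1)
      have h0 : cnt (fun _ : Ω => False) = 0 := by simp [cnt]
      have := cnt_nonneg (av A S)
      have : 0 ≤ 2 * p * cnt (av A S) := by positivity
      linarith
    · by_cases hd : Disjoint S (N i)
      · rw [h1 i S hi hd]
        nlinarith [cnt_nonneg (av A S), mul_nonneg hp (cnt_nonneg (av A S))]
      · have hss : S \ N i ⊂ S := by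
          refine Finset.ssubset_iff_subset_ne.2 ⟨Finset.sdiff_subset, ?_⟩
          intro h
          exact hd (Finset.sdiff_eq_self_iff_disjoint.1 h)
        have hh := half_step A (N i) S p (h3 i) (fun j _ => ih _ hss j)
        have e1 := h1 i (S \ N i) (by simp [hi]) Finset.sdiff_disjoint
        have e2 : cnt (fun w => A i w ∧ av A S w) ≤ cnt (fun w => A i w ∧ av A (S \ N i) w) :=
          cnt_mono (fun w hw => ⟨hw.1, fun j hj => hw.2 j (Finset.sdiff_subset hj)⟩)
        rw [e1] at e2
        nlinarith [mul_le_mul_of_nonneg_left hh hp]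

/-- A Suen / Janson type inequality. -/
theorem suen {Ω ι : Type*} [Fintype Ω] [DecidableEq ι] (A : ι → Ω → Prop)
    (N : ι → Finset ι) (p : ℝ) (q : ι → ι → ℝ) (hp : 0 ≤ p) (hq : ∀ i j, 0 ≤ q i j)
    (h1 : ∀ i S, i ∉ S → Disjoint S (N i) →
      cnt (fun w => A i w ∧ av A S w) = p * cnt (av A S))
    (h2 : ∀ i, ∀ j ∈ N i, ∀ S, i ∉ S → j ∉ S → Disjoint S (N i) → Disjoint S (N j) →
      cnt (fun w => (A i w ∧ A j w) ∧ av A S w) ≤ q i j * cnt (av A S))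
    (h3 : ∀ i, ((N i).card : ℝ) * p ≤ 1 / 4)
    (h4 : ∀ i, ∑ j ∈ N i, q i j ≤ p / 8) (S : Finset ι) :
    cnt (av A S) ≤ (Fintype.card Ω : ℝ) * Real.exp (-((S.card : ℝ) * p / 2)) := by
  have hl := lll A N p hp h1 h3
  induction S using Finset.induction_on with
  | empty =>
    simp only [cnt, Finset.card_empty, Nat.cast_zero, zero_mul, zero_div, neg_zero, Real.exp_zero,
      mul_one, Nat.cast_le]
    exact Finset.card_le_univ _
  | insert i S hi ih =>
    have hh : ∀ (S : Finset ι) i, cnt (av A (S \ N i)) ≤ 2 * cnt (av A S) :=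
      fun S i => half_step A (N i) S p (h3 i) (fun j _ => hl _ j)
    have e1 := h1 i (S \ N i) (by simp [hi]) Finset.sdiff_disjoint
    have m1 : cnt (av A S) ≤ cnt (av A (S \ N i)) :=
      cnt_mono (fun w hw j hj => hw j (Finset.sdiff_subset hj))
    have u := cnt_union (fun w => A i w ∧ av A (S \ N i) w) (fun w => A i w ∧ av A S w) (N i)
      (fun j w => if j ∈ S then (A i w ∧ A j w) ∧ av A ((S \ N i) \ N j) w else False) (by
        rintro w ⟨hA, hw⟩
        by_cases hS : av A S w
        · exact Or.inl ⟨hA, hS⟩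
        · right
          unfold av at hS
          push Not at hS
          obtain ⟨j, hj, hAj⟩ := hS
          refine ⟨j, ?_, ?_⟩
          · by_contra hD
            exact hw j (by simp [hj, hD]) hAj
          · rw [if_pos hj]
            exact ⟨⟨hA, hAj⟩, fun l hl => hw l (Finset.sdiff_subset hl)⟩)
    have v : ∑ j ∈ N i, cnt (fun w => if j ∈ S then (A i w ∧ A j w) ∧
        av A ((S \ N i) \ N j) w else False) ≤ ∑ j ∈ N i, q i j * (4 * cnt (av A S)) := by
      refine Finset.sum_le_sum (fun j hj => ?_)
      have hb : cnt (fun w => if j ∈ S then (A i w ∧ A j w) ∧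
        av A ((S \ N i) \ N j) w else False) ≤
          cnt (fun w => (A i w ∧ A j w) ∧ av A ((S \ N i) \ N j) w) := by
        refine cnt_mono (fun w hw => ?_)
        split_ifs at hw
        exact hw
      refine hb.trans ((h2 i j hj _ (by simp [hi]) (by simp [hj]) ?_
        Finset.sdiff_disjoint).trans ?_)
      · exact Finset.disjoint_of_subset_left Finset.sdiff_subset Finset.sdiff_disjoint
      · refine mul_le_mul_of_nonneg_left ?_ (hq i j)
        linarith [hh (S \ N i) j, hh S i]
    rw [← Finset.sum_mul] at v
    have v2 := mul_le_mul_of_nonneg_right (h4 i)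
      (mul_nonneg (by norm_num : (0:ℝ) ≤ 4) (cnt_nonneg (av A S)))
    have m2 := mul_le_mul_of_nonneg_left m1 hp
    have sp := cnt_split (av A S) (A i)
    have eq : cnt (av A (insert i S)) = cnt (fun w => ¬ A i w ∧ av A S w) := by
      congr 1
      funext w
      simp [av]
    have key : cnt (av A (insert i S)) ≤ cnt (av A S) * (1 - p / 2) := by
      rw [eq]; linarith
    have ex : 1 - p / 2 ≤ Real.exp (-(p / 2)) := by
      linarith [Real.add_one_le_exp (-(p / 2))]
    rw [Finset.card_insert_of_notMem hi]
    calc _ ≤ cnt (av A S) * (1 - p / 2) := key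
      _ ≤ cnt (av A S) * Real.exp (-(p / 2)) := mul_le_mul_of_nonneg_left ex (cnt_nonneg _)
      _ ≤ ((Fintype.card Ω : ℝ) * Real.exp (-((S.card : ℝ) * p / 2))) * Real.exp (-(p / 2)) :=
        mul_le_mul_of_nonneg_right ih (Real.exp_nonneg _)
      _ = _ := by
        rw [mul_assoc, ← Real.exp_add]
        congr 2
        push_cast
        ring

/-- Cylinder events are independent of events living on the complementary cells. -/
theorem cyl {C B : Type*} [Fintype C] [DecidableEq C] [Fintype B]
    (U : Finset C) (v : C → B) (F : (C → B) → Prop)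
    (hF : ∀ M M' : C → B, (∀ c, c ∉ U → M c = M' c) → (F M ↔ F M')) :
    (Fintype.card B : ℝ) ^ U.card * cnt (fun M : C → B => (∀ c ∈ U, M c = v c) ∧ F M) = cnt F := by
  classical
  unfold cnt
  have h := Finset.card_eq_sum_card_fiberwise (s := Finset.univ.filter F)
    (t := (Finset.univ : Finset (U → B))) (f := fun M c => M c.1) (fun _ _ => by simp)
  have h2 : ∀ u ∈ (Finset.univ : Finset (U → B)),
      ((Finset.univ.filter F).filter (fun M => (fun c : U => M c.1) = u)).card =
      (Finset.univ.filter (fun M : C → B => (∀ c ∈ U, M c = v c) ∧ F M)).card := by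
    intro u _
    refine Finset.card_bij' (fun M _ c => if c ∈ U then v c else M c)
      (fun M _ c => if hc : c ∈ U then u ⟨c, hc⟩ else M c) ?_ ?_ ?_ ?_
    · intro M hM
      simp only [Finset.mem_filter, Finset.mem_univ, true_and] at hM ⊢
      refine ⟨fun c hc => by simp [hc], (hF _ _ fun c hc => ?_).1 hM.1⟩
      simp [hc]
    · intro M hM
      simp only [Finset.mem_filter, Finset.mem_univ, true_and] at hM ⊢
      refine ⟨(hF _ _ fun c hc => ?_).1 hM.2, ?_⟩
      · simp [hc]
      · funext c
        simp
    · intro M hM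
      simp only [Finset.mem_filter, Finset.mem_univ, true_and] at hM
      funext c
      by_cases hc : c ∈ U
      · simp [hc, ← hM.2]
      · simp [hc]
    · intro M hM
      simp only [Finset.mem_filter, Finset.mem_univ, true_and] at hM
      funext c
      by_cases hc : c ∈ U
      · simp [hc, hM.1 c hc]
      · simp [hc]
  rw [Finset.sum_congr rfl h2, Finset.sum_const, Finset.card_univ, Fintype.card_fun] at h
  rw [h]
  simp only [Fintype.card_coe, smul_eq_mul]
  push_cast
  congr!

/-- `k`-subsets of `Fin n`. -/
abbrev KS (n k : ℕ) := {R : Finset (Fin n) // R.card = k}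

theorem ks_fiber (n k r : ℕ) (R : KS n k) :
    (Finset.univ.filter (fun R' : KS n k => (R.1 ∩ R'.1).card = r)).card ≤
      k.choose r * n.choose (k - r) := by
  have h := Finset.card_le_card_of_injOn
    (s := Finset.univ.filter (fun R' : KS n k => (R.1 ∩ R'.1).card = r))
    (t := Finset.powersetCard r R.1 ×ˢ Finset.powersetCard (k - r) (Finset.univ : Finset (Fin n)))
    (fun R' => (R.1 ∩ R'.1, R'.1 \ R.1)) ?_ ?_
  · simpa [R.2] using h
  · intro R' hR'
    simp only [Finset.coe_filter, Finset.mem_univ, true_and, Set.mem_ofPred_eq] at hR'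
    simp only [Finset.coe_product, Set.mem_prod, Finset.mem_coe, Finset.mem_powersetCard,
      Finset.inter_subset_left, true_and, Finset.subset_univ]
    refine ⟨hR', ?_⟩
    have := Finset.card_sdiff_add_card_inter R'.1 R.1
    rw [Finset.inter_comm, hR', R'.2] at this
    omega
  · intro X _ Y _ hXY
    simp only [Prod.mk.injEq] at hXY
    apply Subtype.ext
    rw [← Finset.sdiff_union_inter X.1 R.1, ← Finset.sdiff_union_inter Y.1 R.1, hXY.2,
      Finset.inter_comm X.1, Finset.inter_comm Y.1, hXY.1]

theorem ks_eq {n k : ℕ} (R R' : KS n k) (h : (R.1 ∩ R'.1).card = k) : R = R' := by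
  apply Subtype.ext
  have h1 : R.1 ∩ R'.1 = R.1 :=
    Finset.eq_of_subset_of_card_le Finset.inter_subset_left (by rw [h, R.2])
  have h2 : R.1 ∩ R'.1 = R'.1 :=
    Finset.eq_of_subset_of_card_le Finset.inter_subset_right (by rw [h, R'.2])
  rw [← h1, h2]

/-- Neighbours of a position. -/
def nb (n k : ℕ) (i : KS n k × KS n k) : Finset (KS n k × KS n k) :=
  Finset.univ.filter (fun j => j ≠ i ∧ (i.1.1 ∩ j.1.1).Nonempty ∧ (i.2.1 ∩ j.2.1).Nonempty)

theorem nb_sum (a k n : ℕ) (ha : 1 ≤ a)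
    (hD : ∀ r c : ℕ, 1 ≤ r → r ≤ k → 1 ≤ c → c ≤ k → ¬ (r = k ∧ c = k) →
      8 * (k : ℝ) ^ 2 * (((k.choose r * n.choose (k - r) : ℕ) : ℝ) *
        ((k.choose c * n.choose (k - c) : ℕ) : ℝ) * (a : ℝ) ^ (r * c)) ≤ (a : ℝ) ^ (k ^ 2))
    (i : KS n k × KS n k) :
    ∑ j ∈ nb n k i, (a : ℝ) ^ ((i.1.1 ∩ j.1.1).card * (i.2.1 ∩ j.2.1).card) / (a : ℝ) ^ (k ^ 2)
      ≤ 1 / 8 := by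
  have hapos : (0 : ℝ) < a := by exact_mod_cast ha
  by_cases hk : k = 0
  · have : nb n k i = ∅ := by
      ext j
      have : i.1.1 = ∅ := by rw [← Finset.card_eq_zero, i.1.2, hk]
      simp [nb, this]
    rw [this]; norm_num
  have hk0 : (0 : ℝ) < k := by exact_mod_cast Nat.pos_of_ne_zero hk
  have hmaps : ∀ j ∈ nb n k i, ((i.1.1 ∩ j.1.1).card, (i.2.1 ∩ j.2.1).card) ∈
      ((Finset.Icc 1 k ×ˢ Finset.Icc 1 k).erase (k, k)) := by
    intro j hj
    simp only [nb, Finset.mem_filter, Finset.mem_univ, true_and] at hj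
    simp only [Finset.mem_erase, Finset.mem_product, Finset.mem_Icc, ne_eq, Prod.mk.injEq]
    refine ⟨?_, ⟨Finset.card_pos.2 hj.2.1, ?_⟩, Finset.card_pos.2 hj.2.2, ?_⟩
    · rintro ⟨e1, e2⟩
      exact hj.1 (Prod.ext (ks_eq _ _ e1).symm (ks_eq _ _ e2).symm)
    · exact (Finset.card_le_card Finset.inter_subset_left).trans i.1.2.le
    · exact (Finset.card_le_card Finset.inter_subset_left).trans i.2.2.le
  rw [← Finset.sum_fiberwise_of_maps_to hmaps]
  have hb : ∀ y ∈ ((Finset.Icc 1 k ×ˢ Finset.Icc 1 k).erase (k, k)),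
      ∑ j ∈ (nb n k i).filter (fun j => ((i.1.1 ∩ j.1.1).card, (i.2.1 ∩ j.2.1).card) = y),
        (a : ℝ) ^ ((i.1.1 ∩ j.1.1).card * (i.2.1 ∩ j.2.1).card) / (a : ℝ) ^ (k ^ 2)
      ≤ 1 / (8 * (k : ℝ) ^ 2) := by
    rintro ⟨r, c⟩ hy
    simp only [Finset.mem_erase, Finset.mem_product, Finset.mem_Icc, ne_eq, Prod.mk.injEq] at hy
    have e : ∑ j ∈ (nb n k i).filter
          (fun j => ((i.1.1 ∩ j.1.1).card, (i.2.1 ∩ j.2.1).card) = (r, c)),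
        (a : ℝ) ^ ((i.1.1 ∩ j.1.1).card * (i.2.1 ∩ j.2.1).card) / (a : ℝ) ^ (k ^ 2) =
        ∑ j ∈ (nb n k i).filter
          (fun j => ((i.1.1 ∩ j.1.1).card, (i.2.1 ∩ j.2.1).card) = (r, c)),
        (a : ℝ) ^ (r * c) / (a : ℝ) ^ (k ^ 2) := by
      refine Finset.sum_congr rfl (fun j hj => ?_)
      have := (Finset.mem_filter.1 hj).2
      simp only [Prod.mk.injEq] at this
      rw [this.1, this.2]
    rw [e, Finset.sum_const, nsmul_eq_mul]
    have hc : ((nb n k i).filter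
          (fun j => ((i.1.1 ∩ j.1.1).card, (i.2.1 ∩ j.2.1).card) = (r, c))).card ≤
        (k.choose r * n.choose (k - r)) * (k.choose c * n.choose (k - c)) := by
      refine le_trans ?_ (Nat.mul_le_mul (ks_fiber n k r i.1) (ks_fiber n k c i.2))
      rw [← Finset.card_product]
      refine Finset.card_le_card (fun j hj => ?_)
      have := (Finset.mem_filter.1 hj).2
      simp only [Prod.mk.injEq] at this
      simp [this.1, this.2]
    have hc' : (((nb n k i).filter
          (fun j => ((i.1.1 ∩ j.1.1).card, (i.2.1 ∩ j.2.1).card) = (r, c))).card : ℝ) ≤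
        ((k.choose r * n.choose (k - r) : ℕ) : ℝ) * ((k.choose c * n.choose (k - c) : ℕ) : ℝ) := by
      exact_mod_cast hc
    have hh := hD r c hy.2.1.1 hy.2.1.2 hy.2.2.1 hy.2.2.2 hy.1
    rw [← mul_div_assoc, div_le_div_iff₀ (by positivity) (by positivity)]
    have h5 := mul_le_mul_of_nonneg_right hc' (by positivity : (0 : ℝ) ≤ (a : ℝ) ^ (r * c))
    have h6 := mul_le_mul_of_nonneg_left h5 (by positivity : (0 : ℝ) ≤ 8 * (k : ℝ) ^ 2)
    linarith
  refine (Finset.sum_le_sum hb).trans ?_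
  rw [Finset.sum_const, nsmul_eq_mul]
  have hcard : (((Finset.Icc 1 k ×ˢ Finset.Icc 1 k).erase (k, k)).card : ℝ) ≤ (k : ℝ) ^ 2 := by
    have := Finset.card_le_card (Finset.erase_subset (k, k) (Finset.Icc 1 k ×ˢ Finset.Icc 1 k))
    rw [Finset.card_product, Nat.card_Icc, Nat.add_sub_cancel] at this
    rw [sq]
    exact_mod_cast this
  calc _ ≤ (k : ℝ) ^ 2 * (1 / (8 * (k : ℝ) ^ 2)) :=
        mul_le_mul_of_nonneg_right hcard (by positivity)
    _ = 1 / 8 := by field_simp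

/-- The event that `T` occurs at position `i`. -/
def ev {a k n : ℕ} (T : Fin k → Fin k → Fin a) (i : KS n k × KS n k)
    (M : Fin n × Fin n → Fin a) : Prop :=
  ∀ x y, M (i.1.1.orderEmbOfFin i.1.2 x, i.2.1.orderEmbOfFin i.2.2 y) = T x y

theorem ev_congr {a k n : ℕ} (T : Fin k → Fin k → Fin a) (i : KS n k × KS n k)
    (M M' : Fin n × Fin n → Fin a) (h : ∀ c ∈ i.1.1 ×ˢ i.2.1, M c = M' c) :
    ev T i M ↔ ev T i M' := by
  unfold ev
  refine forall_congr' fun x => forall_congr' fun y => ?_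
  rw [h]
  simp [Finset.orderEmbOfFin_mem]

theorem ev_cyl {a k n : ℕ} (T : Fin k → Fin k → Fin a) (i : KS n k × KS n k)
    (v M : Fin n × Fin n → Fin a) (hv : ev T i v) :
    ev T i M ↔ ∀ c ∈ i.1.1 ×ˢ i.2.1, M c = v c := by
  constructor
  · rintro h ⟨c, d⟩ hc
    simp only [Finset.mem_product] at hc
    obtain ⟨x, rfl⟩ : ∃ x, i.1.1.orderEmbOfFin i.1.2 x = c := by
      have : c ∈ Set.range (i.1.1.orderEmbOfFin i.1.2) := by
        rw [Finset.range_orderEmbOfFin]; exact hc.1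
      exact this
    obtain ⟨y, rfl⟩ : ∃ x, i.2.1.orderEmbOfFin i.2.2 x = d := by
      have : d ∈ Set.range (i.2.1.orderEmbOfFin i.2.2) := by
        rw [Finset.range_orderEmbOfFin]; exact hc.2
      exact this
    rw [h x y, hv x y]
  · intro h
    exact (ev_congr T i M v h).2 hv

theorem ev_exists {a k n : ℕ} (ha : 1 ≤ a) (T : Fin k → Fin k → Fin a) (i : KS n k × KS n k) :
    ∃ v, ev T i v := by
  classical
  have inj : Function.Injective (fun z : Fin k × Fin k =>
      ((i.1.1.orderEmbOfFin i.1.2 z.1, i.2.1.orderEmbOfFin i.2.2 z.2) : Fin n × Fin n)) := by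
    rintro ⟨x, y⟩ ⟨x', y'⟩ h
    simpa using h
  refine ⟨Function.extend (fun z : Fin k × Fin k =>
      ((i.1.1.orderEmbOfFin i.1.2 z.1, i.2.1.orderEmbOfFin i.2.2 z.2) : Fin n × Fin n))
      (fun z => T z.1 z.2) (fun _ => ⟨0, ha⟩), fun x y => ?_⟩
  exact inj.extend_apply (fun z => T z.1 z.2) _ (x, y)

theorem nb_disj {n k : ℕ} (i l : KS n k × KS n k) (hl : l ≠ i) (hN : l ∉ nb n k i) :
    Disjoint (i.1.1 ×ˢ i.2.1) (l.1.1 ×ˢ l.2.1) := by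
  rw [Finset.disjoint_left]
  rintro ⟨c, d⟩ h1 h2
  simp only [Finset.mem_product] at h1 h2
  apply hN
  simp only [nb, Finset.mem_filter, Finset.mem_univ, true_and]
  exact ⟨hl, ⟨c, by simp [h1.1, h2.1]⟩, ⟨d, by simp [h1.2, h2.2]⟩⟩

theorem av_congr {a k n : ℕ} (T : Fin k → Fin k → Fin a) (S : Finset (KS n k × KS n k))
    (U : Finset (Fin n × Fin n)) (hU : ∀ l ∈ S, Disjoint U (l.1.1 ×ˢ l.2.1))
    (M M' : Fin n × Fin n → Fin a) (h : ∀ c, c ∉ U → M c = M' c) :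
    av (ev T) S M ↔ av (ev T) S M' := by
  unfold av
  refine forall_congr' fun l => forall_congr' fun hl => not_congr (ev_congr T l _ _ fun c hc => ?_)
  exact h c (fun hcU => Finset.disjoint_left.1 (hU l hl) hcU hc)

theorem miss_bound (a k n : ℕ) (ha : 1 ≤ a)
    (hD : ∀ r c : ℕ, 1 ≤ r → r ≤ k → 1 ≤ c → c ≤ k → ¬ (r = k ∧ c = k) →
      8 * (k : ℝ) ^ 2 * (((k.choose r * n.choose (k - r) : ℕ) : ℝ) *
        ((k.choose c * n.choose (k - c) : ℕ) : ℝ) * (a : ℝ) ^ (r * c)) ≤ (a : ℝ) ^ (k ^ 2))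
    (T : Fin k → Fin k → Fin a) :
    cnt (av (ev (n := n) T) Finset.univ) ≤ (Fintype.card (Fin n × Fin n → Fin a) : ℝ) *
      Real.exp (-((n.choose k : ℝ) ^ 2 * (1 / (a : ℝ) ^ (k ^ 2)) / 2)) := by
  have hapos : (0 : ℝ) < a := by exact_mod_cast ha
  have hs := nb_sum a k n ha hD
  have hcardU : ∀ i : KS n k × KS n k, (i.1.1 ×ˢ i.2.1).card = k ^ 2 := by
    intro i; rw [Finset.card_product, i.1.2, i.2.2, sq]
  have key := suen (ev (n := n) T) (nb n k) (1 / (a : ℝ) ^ (k ^ 2))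
    (fun i j => (1 / (a : ℝ) ^ (k ^ 2)) *
      ((a : ℝ) ^ ((i.1.1 ∩ j.1.1).card * (i.2.1 ∩ j.2.1).card) / (a : ℝ) ^ (k ^ 2)))
    (by positivity) (fun i j => by positivity) ?_ ?_ ?_ ?_ Finset.univ
  · have hc : (Finset.univ : Finset (KS n k × KS n k)).card = n.choose k ^ 2 := by
      rw [Finset.card_univ, Fintype.card_prod, Fintype.card_finset_len, Fintype.card_fin, sq]
    rw [hc] at key
    push_cast at key ⊢
    exact key
  · intro i S hi hd
    obtain ⟨v, hv⟩ := ev_exists ha T i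
    have hU : ∀ l ∈ S, Disjoint (i.1.1 ×ˢ i.2.1) (l.1.1 ×ˢ l.2.1) := fun l hl =>
      nb_disj i l (fun h => hi (h ▸ hl)) (Finset.disjoint_left.1 hd hl)
    have h := cyl (i.1.1 ×ˢ i.2.1) v (av (ev T) S) (av_congr T S _ hU)
    rw [hcardU, Fintype.card_fin] at h
    simp only [← ev_cyl T i v _ hv] at h
    rw [← h]
    field_simp
  · intro i j hj S hi hjS hdi hdj
    by_cases hex : ∃ v, ev T i v ∧ ev T j v
    · obtain ⟨v, hvi, hvj⟩ := hex
      have hU : ∀ l ∈ S, Disjoint ((i.1.1 ×ˢ i.2.1) ∪ (j.1.1 ×ˢ j.2.1)) (l.1.1 ×ˢ l.2.1) :=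
        fun l hl => by
          rw [Finset.disjoint_union_left]
          exact ⟨nb_disj i l (fun h => hi (h ▸ hl)) (Finset.disjoint_left.1 hdi hl),
            nb_disj j l (fun h => hjS (h ▸ hl)) (Finset.disjoint_left.1 hdj hl)⟩
      have h := cyl ((i.1.1 ×ˢ i.2.1) ∪ (j.1.1 ×ˢ j.2.1)) v (av (ev T) S) (av_congr T S _ hU)
      have hc := Finset.card_union_add_card_inter (i.1.1 ×ˢ i.2.1) (j.1.1 ×ˢ j.2.1)
      rw [hcardU, hcardU, Finset.product_inter_product, Finset.card_product] at hc
      have e : ∀ M, (∀ c ∈ (i.1.1 ×ˢ i.2.1) ∪ (j.1.1 ×ˢ j.2.1), M c = v c) ↔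
          (ev T i M ∧ ev T j M) := by
        intro M
        rw [ev_cyl T i v M hvi, ev_cyl T j v M hvj]
        simp only [Finset.mem_union, or_imp, forall_and]
      simp only [e, Fintype.card_fin] at h
      rw [← h]
      have hpw : (a : ℝ) ^ ((i.1.1 ×ˢ i.2.1) ∪ (j.1.1 ×ˢ j.2.1)).card *
          (a : ℝ) ^ ((i.1.1 ∩ j.1.1).card * (i.2.1 ∩ j.2.1).card) =
          (a : ℝ) ^ (k ^ 2) * (a : ℝ) ^ (k ^ 2) := by
        rw [← pow_add, ← pow_add, hc]
      apply le_of_eq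
      rw [← mul_assoc, one_div_mul_eq_div, div_div, div_mul_eq_mul_div, mul_comm ((a : ℝ) ^ _)
        ((a : ℝ) ^ (Finset.card _)), hpw, div_self (by positivity), one_mul]
    · have h0 : cnt (fun w => (ev T i w ∧ ev T j w) ∧ av (ev T) S w) ≤
          cnt (fun _ : Fin n × Fin n → Fin a => False) :=
        cnt_mono (fun w hw => hex ⟨w, hw.1⟩)
      have h1 : cnt (fun _ : Fin n × Fin n → Fin a => False) = 0 := by simp [cnt]
      rw [h1] at h0
      exact h0.trans (mul_nonneg (by positivity) (cnt_nonneg _))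
  · intro i
    have : ((nb n k i).card : ℝ) * (1 / (a : ℝ) ^ (k ^ 2)) ≤
        ∑ j ∈ nb n k i,
          (a : ℝ) ^ ((i.1.1 ∩ j.1.1).card * (i.2.1 ∩ j.2.1).card) / (a : ℝ) ^ (k ^ 2) := by
      rw [← nsmul_eq_mul]
      refine Finset.card_nsmul_le_sum _ _ _ (fun j _ => ?_)
      refine div_le_div_of_nonneg_right ?_ (by positivity)
      exact one_le_pow₀ (by exact_mod_cast ha)
    linarith [hs i]
  · intro i
    rw [← Finset.mul_sum]
    have := mul_le_mul_of_nonneg_left (hs i) (by positivity : 0 ≤ 1 / (a : ℝ) ^ (k ^ 2))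
    linarith

theorem exists_omni (a k n : ℕ) (ha : 1 ≤ a)
    (hD : ∀ r c : ℕ, 1 ≤ r → r ≤ k → 1 ≤ c → c ≤ k → ¬ (r = k ∧ c = k) →
      8 * (k : ℝ) ^ 2 * (((k.choose r * n.choose (k - r) : ℕ) : ℝ) *
        ((k.choose c * n.choose (k - c) : ℕ) : ℝ) * (a : ℝ) ^ (r * c)) ≤ (a : ℝ) ^ (k ^ 2))
    (hM : (a : ℝ) ^ (k ^ 2) *
      Real.exp (-((n.choose k : ℝ) ^ 2 * (1 / (a : ℝ) ^ (k ^ 2)) / 2)) < 1) :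
    ∃ M : Fin n → Fin n → Fin a, IsOmnimosaic a k M := by
  classical
  by_contra hno
  push Not at hno
  have hapos : 0 < a := ha
  have : Nonempty (Fin a) := ⟨⟨0, ha⟩⟩
  have hu := cnt_union (fun _ : Fin n × Fin n → Fin a => True) (fun _ => False)
    (Finset.univ : Finset (Fin k → Fin k → Fin a)) (fun T => av (ev (n := n) T) Finset.univ) (by
      intro M _
      right
      have h := hno (fun x y => M (x, y))
      unfold IsOmnimosaic at h
      push Not at h
      obtain ⟨T, hT⟩ := h
      refine ⟨T, Finset.mem_univ _, fun i _ hi => ?_⟩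
      obtain ⟨x, y, hxy⟩ := hT (i.1.1.orderEmbOfFin i.1.2) (i.2.1.orderEmbOfFin i.2.2)
        (OrderEmbedding.strictMono _) (OrderEmbedding.strictMono _)
      exact hxy (hi x y).symm)
  have e1 : cnt (fun _ : Fin n × Fin n → Fin a => True) =
      (Fintype.card (Fin n × Fin n → Fin a) : ℝ) := by
    simp [cnt]
  have e2 : cnt (fun _ : Fin n × Fin n → Fin a => False) = 0 := by simp [cnt]
  have hs := Finset.sum_le_sum (fun T (_ : T ∈ (Finset.univ : Finset (Fin k → Fin k → Fin a))) =>
    miss_bound a k n ha hD T)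
  rw [Finset.sum_const, nsmul_eq_mul, Finset.card_univ] at hs
  have e3 : ((Fintype.card (Fin k → Fin k → Fin a) : ℕ) : ℝ) = (a : ℝ) ^ (k ^ 2) := by
    simp [← pow_mul, sq]
  rw [e3] at hs
  rw [e1, e2] at hu
  have hpos : (0 : ℝ) < (Fintype.card (Fin n × Fin n → Fin a) : ℝ) := by
    exact_mod_cast Fintype.card_pos
  have := mul_lt_mul_of_pos_left hM hpos
  nlinarith

theorem choose_le_pow' (n m : ℕ) : n.choose m ≤ n ^ m :=
  (Nat.choose_le_descFactorial n m).trans (Nat.descFactorial_le_pow n m)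

theorem hD_of (a k n : ℕ) (ha : 2 ≤ a) (hk : 1 ≤ k) (Q : ℝ) (hQ : 0 < Q)
    (hQ4 : Q ^ 4 = (a : ℝ) ^ k) (F1 : (n : ℝ) ≤ k * Q ^ 2)
    (F2 : (k : ℝ) * Q ^ 2 / Real.exp 1 ≤ n)
    (F3 : (n : ℝ) ^ k / (k.factorial : ℝ) ≤ Real.exp 1 * (k : ℝ) ^ 2 * (Q ^ 2) ^ k)
    (F5 : 8 * Real.exp 1 ^ 3 * (k : ℝ) ^ 7 ≤ Q) :
    ∀ r c : ℕ, 1 ≤ r → r ≤ k → 1 ≤ c → c ≤ k → ¬ (r = k ∧ c = k) →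
      8 * (k : ℝ) ^ 2 * (((k.choose r * n.choose (k - r) : ℕ) : ℝ) *
        ((k.choose c * n.choose (k - c) : ℕ) : ℝ) * (a : ℝ) ^ (r * c)) ≤ (a : ℝ) ^ (k ^ 2) := by
  have hapos : (0 : ℝ) < a := by exact_mod_cast (by omega : 0 < a)
  have ha1 : (1 : ℝ) ≤ a := by exact_mod_cast (by omega : 1 ≤ a)
  have hk1 : (1 : ℝ) ≤ k := by exact_mod_cast hk
  have hk0 : (0 : ℝ) < k := by linarith
  have he : (1 : ℝ) ≤ Real.exp 1 := Real.one_le_exp (by norm_num)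
  have he0 : (0 : ℝ) < Real.exp 1 := Real.exp_pos 1
  have hn0 : (0 : ℝ) < n := lt_of_lt_of_le (by positivity) F2
  have hpowQ : ∀ x t : ℕ, 4 * x ≤ k * t → (a : ℝ) ^ x ≤ Q ^ t := by
    intro x t h
    have : ((a : ℝ) ^ x) ^ 4 ≤ (Q ^ t) ^ 4 := by
      rw [← pow_mul, ← pow_mul, mul_comm t 4, pow_mul Q, hQ4, ← pow_mul]
      exact pow_le_pow_right₀ ha1 (by omega)
    exact le_of_pow_le_pow_left₀ (by norm_num) (by positivity) this
  have hs2k : (Q ^ 2) ^ k * (Q ^ 2) ^ k = (a : ℝ) ^ (k ^ 2) := by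
    rw [← mul_pow, ← pow_add, hQ4, ← pow_mul, sq]
  have W1 : ∀ r, r ≤ k → ((k.choose r * n.choose (k - r) : ℕ) : ℝ) ≤
      ((k : ℝ) ^ 2 * Q ^ 2) ^ (k - r) := by
    intro r hr
    rw [← Nat.choose_symm hr]
    have h1 : (k.choose (k - r) * n.choose (k - r) : ℕ) ≤ (k * n) ^ (k - r) := by
      rw [mul_pow]
      exact Nat.mul_le_mul (choose_le_pow' _ _) (choose_le_pow' _ _)
    calc ((k.choose (k - r) * n.choose (k - r) : ℕ) : ℝ) ≤ (((k * n) ^ (k - r) : ℕ) : ℝ) := by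
          exact_mod_cast h1
      _ = ((k : ℝ) * n) ^ (k - r) := by push_cast; ring
      _ ≤ _ := by
          refine pow_le_pow_left₀ (by positivity) ?_ _
          nlinarith
  have W2 : ∀ r, r ≤ k → ((k.choose r * n.choose (k - r) : ℕ) : ℝ) * (Q ^ 2) ^ r ≤
      (Real.exp 1 * k) ^ r * (Real.exp 1 * (k : ℝ) ^ 2 * (Q ^ 2) ^ k) := by
    intro r hr
    have h1 : ((k.choose r : ℕ) : ℝ) ≤ (k : ℝ) ^ r := by exact_mod_cast choose_le_pow' k r
    have h2 : ((n.choose (k - r) : ℕ) : ℝ) ≤ (n : ℝ) ^ (k - r) / ((k - r).factorial : ℝ) :=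
      Nat.choose_le_pow_div _ _
    have h3 : (k.factorial : ℝ) ≤ ((k - r).factorial : ℝ) * (k : ℝ) ^ r := by
      have := Nat.factorial_mul_descFactorial hr
      have h4 := Nat.mul_le_mul_left (k - r).factorial (Nat.descFactorial_le_pow k r)
      rw [this] at h4
      exact_mod_cast h4
    have hf1 : (0 : ℝ) < ((k - r).factorial : ℝ) := by exact_mod_cast Nat.factorial_pos _
    have hf2 : (0 : ℝ) < (k.factorial : ℝ) := by exact_mod_cast Nat.factorial_pos _
    have h5 : ((n.choose (k - r) : ℕ) : ℝ) * (n : ℝ) ^ r ≤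
        (k : ℝ) ^ r * ((n : ℝ) ^ k / (k.factorial : ℝ)) := by
      calc _ ≤ (n : ℝ) ^ (k - r) / ((k - r).factorial : ℝ) * (n : ℝ) ^ r :=
            mul_le_mul_of_nonneg_right h2 (by positivity)
        _ = (n : ℝ) ^ k / ((k - r).factorial : ℝ) := by
            rw [div_mul_eq_mul_div, ← pow_add, Nat.sub_add_cancel hr]
        _ ≤ _ := by
            rw [← mul_div_assoc, div_le_div_iff₀ hf1 hf2]
            have := mul_le_mul_of_nonneg_left h3 (by positivity : 0 ≤ (n : ℝ) ^ k)
            linarith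
    have h6 : ((n.choose (k - r) : ℕ) : ℝ) * ((k : ℝ) * Q ^ 2 / Real.exp 1) ^ r ≤
        (k : ℝ) ^ r * (Real.exp 1 * (k : ℝ) ^ 2 * (Q ^ 2) ^ k) := by
      refine le_trans ?_ (h5.trans (mul_le_mul_of_nonneg_left F3 (by positivity)))
      refine mul_le_mul_of_nonneg_left ?_ (by positivity)
      exact pow_le_pow_left₀ (by positivity) F2 r
    have h7 : ((n.choose (k - r) : ℕ) : ℝ) * (Q ^ 2) ^ r ≤
        Real.exp 1 ^ r * (Real.exp 1 * (k : ℝ) ^ 2 * (Q ^ 2) ^ k) := by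
      rw [div_pow, mul_pow] at h6
      have hkr : (0 : ℝ) < (k : ℝ) ^ r := by positivity
      have her : (0 : ℝ) < Real.exp 1 ^ r := by positivity
      rw [← mul_div_assoc, div_le_iff₀ her] at h6
      refine le_of_mul_le_mul_left ?_ hkr
      linarith
    push_cast
    rw [mul_pow]
    calc _ = ((k.choose r : ℕ) : ℝ) * (((n.choose (k - r) : ℕ) : ℝ) * (Q ^ 2) ^ r) := by ring
      _ ≤ (k : ℝ) ^ r * (Real.exp 1 ^ r * (Real.exp 1 * (k : ℝ) ^ 2 * (Q ^ 2) ^ k)) :=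
        mul_le_mul h1 h7 (by positivity) (by positivity)
      _ = _ := by ring
  intro r c hr1 hrk hc1 hck hne
  set Wr := ((k.choose r * n.choose (k - r) : ℕ) : ℝ) with hWr
  set Wc := ((k.choose c * n.choose (k - c) : ℕ) : ℝ) with hWc
  have hWr0 : 0 ≤ Wr := Nat.cast_nonneg _
  have hWc0 : 0 ≤ Wc := Nat.cast_nonneg _
  by_cases hcase : r + c ≤ k
  · -- few common rows and columns
    have h1 := mul_le_mul (W2 r hrk) (W2 c hck) (by positivity) (by positivity)
    have hx : (a : ℝ) ^ (r * c) ≤ Q ^ (r + c) := by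
      apply hpowQ
      nlinarith [sq_nonneg ((r : ℤ) - c), Nat.mul_le_mul_right (r + c) hcase,
        two_mul_le_add_sq r c]
    have h2 : Wr * Wc * (Q ^ 2) ^ (r + c) ≤
        (Real.exp 1 * k) ^ (r + c) * (Real.exp 1 ^ 2 * (k : ℝ) ^ 4) * (a : ℝ) ^ (k ^ 2) := by
      rw [← hs2k]
      calc _ = Wr * (Q ^ 2) ^ r * (Wc * (Q ^ 2) ^ c) := by ring
        _ ≤ _ := h1
        _ = _ := by ring
    have hu : 8 * (k : ℝ) ^ 2 * ((Real.exp 1 * k) ^ (r + c) * (Real.exp 1 ^ 2 * (k : ℝ) ^ 4)) ≤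
        Q ^ (r + c) := by
      have hb : 1 ≤ 8 * Real.exp 1 ^ 2 * (k : ℝ) ^ 6 := by
        have := one_le_pow₀ he (n := 2)
        have := one_le_pow₀ hk1 (n := 6)
        nlinarith
      calc _ = (8 * Real.exp 1 ^ 2 * (k : ℝ) ^ 6) * (Real.exp 1 * k) ^ (r + c) := by ring
        _ ≤ (8 * Real.exp 1 ^ 2 * (k : ℝ) ^ 6) ^ (r + c) * (Real.exp 1 * k) ^ (r + c) :=
            mul_le_mul_of_nonneg_right (le_self_pow₀ hb (by omega)) (by positivity)
        _ = (8 * Real.exp 1 ^ 3 * (k : ℝ) ^ 7) ^ (r + c) := by rw [← mul_pow]; congr 1; ring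
        _ ≤ _ := pow_le_pow_left₀ (by positivity) F5 _
    have hQu : 0 < (Q ^ 2) ^ (r + c) := by positivity
    refine le_of_mul_le_mul_right ?_ hQu
    calc _ = 8 * (k : ℝ) ^ 2 * ((Wr * Wc * (Q ^ 2) ^ (r + c)) * (a : ℝ) ^ (r * c)) := by ring
      _ ≤ 8 * (k : ℝ) ^ 2 * (((Real.exp 1 * k) ^ (r + c) * (Real.exp 1 ^ 2 * (k : ℝ) ^ 4) *
          (a : ℝ) ^ (k ^ 2)) * Q ^ (r + c)) := by
            refine mul_le_mul_of_nonneg_left ?_ (by positivity)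
            exact mul_le_mul h2 hx (by positivity) (by positivity)
      _ = (8 * (k : ℝ) ^ 2 * ((Real.exp 1 * k) ^ (r + c) * (Real.exp 1 ^ 2 * (k : ℝ) ^ 4))) *
          ((a : ℝ) ^ (k ^ 2) * Q ^ (r + c)) := by ring
      _ ≤ Q ^ (r + c) * ((a : ℝ) ^ (k ^ 2) * Q ^ (r + c)) :=
          mul_le_mul_of_nonneg_right hu (by positivity)
      _ = _ := by ring
  · -- many common rows and columns
    obtain ⟨m, hm⟩ := Nat.exists_eq_add_of_le hrk
    obtain ⟨l, hl⟩ := Nat.exists_eq_add_of_le hck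
    have hmr : k - r = m := by omega
    have hlc : k - c = l := by omega
    have h1 := mul_le_mul (W1 r hrk) (W1 c hck) (by positivity) (by positivity)
    rw [← hWr, ← hWc, hmr, hlc, ← pow_add] at h1
    have ht : m + l ≤ k := by omega
    have ht1 : m + l ≠ 0 := by
      intro h
      apply hne
      omega
    have hx : (a : ℝ) ^ (m * l) ≤ Q ^ (m + l) := by
      apply hpowQ
      nlinarith [Nat.mul_le_mul_right (m + l) ht, two_mul_le_add_sq m l]
    have hy : (a : ℝ) ^ (r * c) * (Q ^ 4) ^ (m + l) = (a : ℝ) ^ (k ^ 2) * (a : ℝ) ^ (m * l) := by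
      rw [hQ4, ← pow_mul, ← pow_add, ← pow_add]
      congr 1
      have hc' : c = k - l := by omega
      zify at hm hl ⊢
      have e1 : (r : ℤ) = k - m := by linarith
      have e2 : (c : ℤ) = k - l := by linarith
      rw [e1, e2]; ring
    have hu : 8 * (k : ℝ) ^ 2 * ((k : ℝ) ^ 2) ^ (m + l) ≤ Q ^ (m + l) := by
      have hb : 1 ≤ 8 * (k : ℝ) ^ 2 := by
        have := one_le_pow₀ hk1 (n := 2)
        nlinarith
      calc _ ≤ (8 * (k : ℝ) ^ 2) ^ (m + l) * ((k : ℝ) ^ 2) ^ (m + l) :=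
            mul_le_mul_of_nonneg_right (le_self_pow₀ hb ht1) (by positivity)
        _ = (8 * (k : ℝ) ^ 4) ^ (m + l) := by rw [← mul_pow]; congr 1; ring
        _ ≤ _ := by
            refine pow_le_pow_left₀ (by positivity) (le_trans ?_ F5) _
            have h3 := one_le_pow₀ he (n := 3)
            have h4 : (k : ℝ) ^ 4 ≤ (k : ℝ) ^ 7 := pow_le_pow_right₀ hk1 (by norm_num)
            have := mul_le_mul h3 h4 (by positivity) (by positivity)
            linarith
    have hQu : 0 < (Q ^ 4) ^ (m + l) := by positivity
    refine le_of_mul_le_mul_right ?_ hQu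
    calc _ = 8 * (k : ℝ) ^ 2 * ((Wr * Wc) * ((a : ℝ) ^ (r * c) * (Q ^ 4) ^ (m + l))) := by ring
      _ = 8 * (k : ℝ) ^ 2 * ((Wr * Wc) * ((a : ℝ) ^ (k ^ 2) * (a : ℝ) ^ (m * l))) := by rw [hy]
      _ ≤ 8 * (k : ℝ) ^ 2 * (((k : ℝ) ^ 2 * Q ^ 2) ^ (m + l) *
            ((a : ℝ) ^ (k ^ 2) * Q ^ (m + l))) := by
            refine mul_le_mul_of_nonneg_left ?_ (by positivity)
            refine mul_le_mul h1 ?_ (by positivity) (by positivity)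
            exact mul_le_mul_of_nonneg_left hx (by positivity)
      _ = (8 * (k : ℝ) ^ 2 * ((k : ℝ) ^ 2) ^ (m + l)) *
            ((Q ^ 2) ^ (m + l) * ((a : ℝ) ^ (k ^ 2) * Q ^ (m + l))) := by
            rw [mul_pow]; ring
      _ ≤ Q ^ (m + l) * ((Q ^ 2) ^ (m + l) * ((a : ℝ) ^ (k ^ 2) * Q ^ (m + l))) :=
          mul_le_mul_of_nonneg_right hu (by positivity)
      _ = _ := by ring

theorem fact_upper (k : ℕ) (hk : 1 ≤ k) :
    (k.factorial : ℝ) ≤ Real.exp 1 * √(k : ℝ) * ((k : ℝ) / Real.exp 1) ^ k := by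
  obtain ⟨m, rfl⟩ : ∃ m, k = m + 1 := ⟨k - 1, by omega⟩
  have h := Stirling.stirlingSeq'_antitone (Nat.zero_le m)
  simp only [Function.comp_apply, Nat.succ_eq_add_one, zero_add, Stirling.stirlingSeq_one] at h
  unfold Stirling.stirlingSeq at h
  have hm : (0 : ℝ) < ((m + 1 : ℕ) : ℝ) := by positivity
  rw [div_le_iff₀ (by positivity), Real.sqrt_mul (by norm_num)] at h
  refine h.trans (le_of_eq ?_)
  have : √(2 : ℝ) ≠ 0 := by positivity
  field_simp

theorem fact_lower (k : ℕ) : ((k : ℝ) / Real.exp 1) ^ k ≤ (k.factorial : ℝ) := by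
  have h := Real.pow_div_factorial_le_exp (k : ℝ) (Nat.cast_nonneg k) k
  have hf2 : (0 : ℝ) < (k.factorial : ℝ) := by exact_mod_cast Nat.factorial_pos _
  rw [div_le_iff₀ hf2] at h
  rw [div_pow, div_le_iff₀ (by positivity), ← Real.exp_nat_mul, mul_one]
  linarith

set_option maxHeartbeats 2000000 in
/-- The construction works for one specific size, under explicit largeness conditions. -/
theorem one_size (a k : ℕ) (ha : 2 ≤ a) (hk : 2 ≤ k) (Q : ℝ) (hQ : 0 < Q)
    (hQ4 : Q ^ 4 = (a : ℝ) ^ k)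
    (C1 : 2 * Real.log k ^ 2 / k ≤ Real.log 2) (C2 : 2 * Real.log k / k ≤ 1 / 5)
    (C4 : 32 * Real.exp 1 ^ 2 * Real.log a < k)
    (C5 : 8 * Real.exp 1 ^ 3 * (k : ℝ) ^ 7 ≤ Q) :
    ∃ M : Fin ⌈(k : ℝ) * Q ^ 2 / Real.exp 1 * (1 + 2 * Real.log k / k)⌉₊ →
      Fin ⌈(k : ℝ) * Q ^ 2 / Real.exp 1 * (1 + 2 * Real.log k / k)⌉₊ → Fin a,
      IsOmnimosaic a k M := by
  set ε : ℝ := 2 * Real.log k / k with hε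
  set B : ℝ := (k : ℝ) * Q ^ 2 / Real.exp 1 * (1 + ε) with hB
  set n : ℕ := ⌈B⌉₊ with hn
  have hapos : (0 : ℝ) < a := by exact_mod_cast (by omega : 0 < a)
  have hk2 : (2 : ℝ) ≤ k := by exact_mod_cast hk
  have hk0 : (0 : ℝ) < k := by linarith
  have hlog : 0 ≤ Real.log k := Real.log_nonneg (by linarith)
  have hε0 : 0 ≤ ε := by positivity
  have he2 : (2.7 : ℝ) ≤ Real.exp 1 := by linarith [Real.exp_one_gt_d9]
  have he3 : Real.exp 1 ≤ 2.72 := by linarith [Real.exp_one_lt_d9]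
  have he0 : (0 : ℝ) < Real.exp 1 := Real.exp_pos 1
  have hf2 : (0 : ℝ) < (k.factorial : ℝ) := by exact_mod_cast Nat.factorial_pos _
  -- Q is big
  have hQk : 2 * Real.exp 1 * k ≤ Q := by
    refine le_trans ?_ C5
    have h1 : (1 : ℝ) ≤ Real.exp 1 ^ 2 := one_le_pow₀ (by linarith)
    have h2 : (1 : ℝ) ≤ (k : ℝ) ^ 6 := one_le_pow₀ (by linarith)
    have h3 : (1 : ℝ) ≤ 4 * (Real.exp 1 ^ 2 * (k : ℝ) ^ 6) := by nlinarith
    have h4 : 0 ≤ 2 * Real.exp 1 * k := by positivity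
    calc 2 * Real.exp 1 * k ≤ (2 * Real.exp 1 * k) * (4 * (Real.exp 1 ^ 2 * (k : ℝ) ^ 6)) :=
          le_mul_of_one_le_right h4 h3
      _ = _ := by ring
  have hQ1 : 1 ≤ Q := by nlinarith
  have hQQ : Q ≤ Q ^ 2 := by nlinarith
  have hQ2 : 2 * Real.exp 1 * k ≤ Q ^ 2 := hQk.trans hQQ
  have hbase : 2 * (k : ℝ) ^ 2 ≤ (k : ℝ) * Q ^ 2 / Real.exp 1 := by
    rw [le_div_iff₀ he0]
    nlinarith
  have hbase0 : 0 < (k : ℝ) * Q ^ 2 / Real.exp 1 := by positivity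
  have hBb : (k : ℝ) * Q ^ 2 / Real.exp 1 ≤ B := by
    rw [hB]
    exact le_mul_of_one_le_right hbase0.le (by linarith)
  have hB0 : 0 < B := lt_of_lt_of_le hbase0 hBb
  have hBn : B ≤ n := Nat.le_ceil B
  have hnB : (n : ℝ) ≤ B + 1 := (Nat.ceil_lt_add_one hB0.le).le
  have hn0 : (0 : ℝ) < n := by linarith
  have hBk : (k : ℝ) ≤ B := by nlinarith
  have F2 : (k : ℝ) * Q ^ 2 / Real.exp 1 ≤ n := hBb.trans hBn
  have F1 : (n : ℝ) ≤ k * Q ^ 2 := by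
    have h1 : B ≤ (k : ℝ) * Q ^ 2 / 2 := by
      rw [hB, div_mul_eq_mul_div, div_le_div_iff₀ he0 (by norm_num)]
      have : 0 ≤ (k : ℝ) * Q ^ 2 := by positivity
      nlinarith
    nlinarith
  -- powers of 1 + ε
  have hepsU : (1 + ε) ^ k ≤ (k : ℝ) ^ 2 := by
    calc (1 + ε) ^ k ≤ (Real.exp ε) ^ k :=
          pow_le_pow_left₀ (by linarith) (by linarith [Real.add_one_le_exp ε]) _
      _ = Real.exp (2 * Real.log k) := by
          rw [← Real.exp_nat_mul]; congr 1; rw [hε]; field_simp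
      _ = _ := by
          rw [two_mul, Real.exp_add, Real.exp_log hk0, sq]
  have hepsL : (k : ℝ) ^ 2 / 2 ≤ (1 + ε) ^ k := by
    have h1 := Real.le_log_one_add_of_nonneg hε0
    have h2 : 2 * Real.log k - Real.log 2 ≤ k * Real.log (1 + ε) := by
      refine le_trans ?_ (mul_le_mul_of_nonneg_left h1 hk0.le)
      have e1 : (k : ℝ) * (2 * ε / (ε + 2)) = 4 * Real.log k / (ε + 2) := by
        have : (k : ℝ) * ε = 2 * Real.log k := by rw [hε]; field_simp
        rw [← mul_div_assoc]
        congr 1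
        linarith
      rw [e1, le_div_iff₀ (by linarith)]
      have e2 : ε * Real.log k ≤ Real.log 2 := by
        refine le_trans (le_of_eq ?_) C1
        rw [hε]; ring
      have := Real.log_pos (by norm_num : (1 : ℝ) < 2)
      nlinarith
    have h3 := Real.exp_le_exp.2 h2
    rw [Real.exp_nat_mul, Real.exp_log (by linarith), Real.exp_sub, two_mul, Real.exp_add,
      Real.exp_log hk0, Real.exp_log (by norm_num), ← sq] at h3
    exact h3
  have hBpow : B ^ k = ((k : ℝ) / Real.exp 1) ^ k * (Q ^ 2) ^ k * (1 + ε) ^ k := by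
    rw [← mul_pow, ← mul_pow, hB]; congr 1; ring
  have F3 : (n : ℝ) ^ k / (k.factorial : ℝ) ≤ Real.exp 1 * (k : ℝ) ^ 2 * (Q ^ 2) ^ k := by
    rw [div_le_iff₀ hf2]
    have h1 : (n : ℝ) ^ k ≤ B ^ k * Real.exp 1 := by
      have h2 : (n : ℝ) ≤ B * (1 + 1 / B) := by
        rw [mul_add, mul_one_div_cancel hB0.ne']; linarith
      calc (n : ℝ) ^ k ≤ (B * (1 + 1 / B)) ^ k := pow_le_pow_left₀ hn0.le h2 _
        _ = B ^ k * (1 + 1 / B) ^ k := mul_pow _ _ _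
        _ ≤ B ^ k * Real.exp 1 := by
          refine mul_le_mul_of_nonneg_left ?_ (by positivity)
          calc (1 + 1 / B) ^ k ≤ (Real.exp (1 / B)) ^ k :=
                pow_le_pow_left₀ (by positivity) (by linarith [Real.add_one_le_exp (1 / B)]) _
            _ = Real.exp (k * (1 / B)) := by rw [← Real.exp_nat_mul]
            _ ≤ Real.exp 1 := by
                apply Real.exp_le_exp.2
                rw [mul_one_div, div_le_one hB0]; exact hBk
    refine h1.trans ?_
    rw [hBpow]
    calc _ ≤ (k.factorial : ℝ) * (Q ^ 2) ^ k * (k : ℝ) ^ 2 * Real.exp 1 := by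
          refine mul_le_mul_of_nonneg_right ?_ he0.le
          refine mul_le_mul ?_ hepsU (by positivity) (by positivity)
          exact mul_le_mul_of_nonneg_right (fact_lower k) (by positivity)
      _ = _ := by ring
  have hnk : 2 * (k : ℝ) ^ 2 ≤ n := hbase.trans F2
  have hkn : k ≤ n := by
    have : (k : ℝ) ≤ n := hBk.trans hBn
    exact_mod_cast this
  have F4 : (Q ^ 2) ^ k * (k : ℝ) ^ 2 / (4 * Real.exp 1 * √(k : ℝ)) ≤ (n.choose k : ℝ) := by
    have h1 : ((n : ℝ) - k) ^ k ≤ (k.factorial : ℝ) * (n.choose k : ℝ) := by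
      have h2 := Nat.pow_sub_le_descFactorial n k
      rw [Nat.descFactorial_eq_factorial_mul_choose] at h2
      have h3 : (n - k) ^ k ≤ k.factorial * n.choose k :=
        (Nat.pow_le_pow_left (by omega) k).trans h2
      have h4 : (((n - k) ^ k : ℕ) : ℝ) ≤ ((k.factorial * n.choose k : ℕ) : ℝ) := by
        exact_mod_cast h3
      rw [Nat.cast_pow, Nat.cast_sub hkn, Nat.cast_mul] at h4
      exact h4
    have h2 : (n : ℝ) ^ k / 2 ≤ ((n : ℝ) - k) ^ k := by
      have h3 : -2 ≤ -((k : ℝ) / n) := by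
        have : (k : ℝ) / n ≤ 1 := by rw [div_le_one hn0]; exact_mod_cast hkn
        linarith
      have h4 := one_add_mul_le_pow h3 k
      have h5 : (1 : ℝ) / 2 ≤ 1 + k * -((k : ℝ) / n) := by
        have : (k : ℝ) * (k / n) ≤ 1 / 2 := by
          rw [← mul_div_assoc, div_le_div_iff₀ hn0 (by norm_num)]
          nlinarith
        linarith
      have h6 : ((n : ℝ) - k) ^ k = (n : ℝ) ^ k * (1 + -((k : ℝ) / n)) ^ k := by
        rw [← mul_pow]; congr 1; field_simp; ring
      rw [h6]
      have := mul_le_mul_of_nonneg_left (h5.trans h4) (by positivity : 0 ≤ (n : ℝ) ^ k)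
      linarith
    have h3 : B ^ k ≤ (n : ℝ) ^ k := pow_le_pow_left₀ hB0.le hBn _
    have hE0 : 0 < ((k : ℝ) / Real.exp 1) ^ k := by positivity
    have hS0 : 0 < (Q ^ 2) ^ k := by positivity
    have h4 : ((k : ℝ) / Real.exp 1) ^ k * ((Q ^ 2) ^ k * ((k : ℝ) ^ 2 / 2)) / 2 ≤
        (k.factorial : ℝ) * (n.choose k : ℝ) := by
      have : ((k : ℝ) / Real.exp 1) ^ k * ((Q ^ 2) ^ k * ((k : ℝ) ^ 2 / 2)) ≤ B ^ k := by
        rw [hBpow, mul_assoc]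
        exact mul_le_mul_of_nonneg_left (mul_le_mul_of_nonneg_left hepsL hS0.le) hE0.le
      linarith
    have h5 := h4.trans (mul_le_mul_of_nonneg_right (fact_upper k (by omega))
      (Nat.cast_nonneg (n.choose k)))
    have hsq : 0 < √(k : ℝ) := by positivity
    rw [div_le_iff₀ (by positivity)]
    refine le_of_mul_le_mul_left ?_ hE0
    linarith
  have hD := hD_of a k n ha (by omega) Q hQ hQ4 F1 F2 F3 C5
  refine exists_omni a k n (by omega) hD ?_
  have hP : (a : ℝ) ^ (k ^ 2) = ((Q ^ 2) ^ k) ^ 2 := by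
    rw [← pow_mul, ← pow_mul, show 2 * (k * 2) = 4 * k by ring, pow_mul, hQ4, ← pow_mul, sq]
  have hmu : (k : ℝ) ^ 3 / (16 * Real.exp 1 ^ 2) ≤
      (n.choose k : ℝ) ^ 2 * (1 / (a : ℝ) ^ (k ^ 2)) := by
    have h1 := pow_le_pow_left₀ (by positivity) F4 2
    rw [div_pow, mul_pow, mul_pow, mul_pow, Real.sq_sqrt hk0.le, ← hP] at h1
    have h2 := mul_le_mul_of_nonneg_right h1 (by positivity : 0 ≤ 1 / (a : ℝ) ^ (k ^ 2))
    refine le_trans (le_of_eq ?_) h2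
    field_simp
    ring
  have hlt : (k : ℝ) ^ 2 * Real.log a < (k : ℝ) ^ 3 / (16 * Real.exp 1 ^ 2) / 2 := by
    rw [div_div, lt_div_iff₀ (by positivity)]
    have := mul_lt_mul_of_pos_left C4 (by positivity : (0 : ℝ) < (k : ℝ) ^ 2)
    nlinarith
  have hpow : (a : ℝ) ^ (k ^ 2) = Real.exp ((k : ℝ) ^ 2 * Real.log a) := by
    have : ((k : ℝ) ^ 2) = ((k ^ 2 : ℕ) : ℝ) := by push_cast; ring
    rw [this, Real.exp_nat_mul, Real.exp_log hapos]
  have hexp : (a : ℝ) ^ (k ^ 2) *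
      Real.exp (-((n.choose k : ℝ) ^ 2 * (1 / (a : ℝ) ^ (k ^ 2)) / 2)) =
      Real.exp ((k : ℝ) ^ 2 * Real.log a +
        -((n.choose k : ℝ) ^ 2 * (1 / (a : ℝ) ^ (k ^ 2)) / 2)) := by
    rw [Real.exp_add, ← hpow]
  rw [hexp]
  refine (Real.exp_lt_exp.2 ?_).trans_eq Real.exp_zero
  linarith

theorem extend_omni (a k m n : ℕ) (ha : 1 ≤ a) (h : m ≤ n)
    (hM : ∃ M : Fin m → Fin m → Fin a, IsOmnimosaic a k M) :
    ∃ M : Fin n → Fin n → Fin a, IsOmnimosaic a k M := by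
  obtain ⟨M, hM⟩ := hM
  refine ⟨fun x y => if hxy : x.1 < m ∧ y.1 < m then M ⟨x.1, hxy.1⟩ ⟨y.1, hxy.2⟩ else ⟨0, ha⟩,
    fun T => ?_⟩
  obtain ⟨ρ, σ, h1, h2, h3⟩ := hM T
  refine ⟨fun i => Fin.castLE h (ρ i), fun j => Fin.castLE h (σ j), ?_, ?_, ?_⟩
  · exact (Fin.strictMono_castLE h).comp h1
  · exact (Fin.strictMono_castLE h).comp h2
  · intro i j
    rw [h3 i j]
    simp

open Filter Topology in
theorem omega_upper_bound_asymptotic (a : ℕ) (ha : 2 ≤ a) :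
    ∃ K : ℕ, ∀ k : ℕ, K ≤ k → ∀ n : ℕ,
      (n : ℝ) ≥ (k : ℝ) * (a : ℝ) ^ ((k : ℝ) / 2) / Real.exp 1 *
        (1 + 2 * Real.log k / k) →
      ∃ M : Fin n → Fin n → Fin a, IsOmnimosaic a k M := by
  have hapos : (0 : ℝ) < a := by exact_mod_cast (by omega : 0 < a)
  have ha1 : (1 : ℝ) < a := by exact_mod_cast (by omega : 1 < a)
  have lim : ∀ d : ℕ, Tendsto (fun k : ℕ => Real.log (k : ℝ) ^ d / (k : ℝ)) atTop (𝓝 0) :=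
    fun d => (Real.isLittleO_pow_log_id_atTop (n := d)).tendsto_div_nhds_zero.comp
      tendsto_natCast_atTop_atTop
  have E1 : ∀ᶠ k : ℕ in atTop, 2 * Real.log k ^ 2 / k ≤ Real.log 2 := by
    have hl := Real.log_pos (by norm_num : (1 : ℝ) < 2)
    filter_upwards [(lim 2).eventually_le_const (by positivity : 0 < Real.log 2 / 2)] with k hk
    rw [mul_div_assoc]; linarith
  have E2 : ∀ᶠ k : ℕ in atTop, 2 * Real.log k / k ≤ 1 / 5 := by
    filter_upwards [(lim 1).eventually_le_const (by norm_num : (0 : ℝ) < 1 / 10)] with k hk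
    rw [pow_one] at hk
    rw [mul_div_assoc]; linarith
  have E4 : ∀ᶠ k : ℕ in atTop, 32 * Real.exp 1 ^ 2 * Real.log a < k :=
    tendsto_natCast_atTop_atTop.eventually_gt_atTop _
  have E5 : ∀ᶠ k : ℕ in atTop,
      8 * Real.exp 1 ^ 3 * (k : ℝ) ^ 7 ≤ ((a : ℝ) ^ ((1 : ℝ) / 4)) ^ k := by
    have hr : 1 < (a : ℝ) ^ ((1 : ℝ) / 4) := Real.one_lt_rpow ha1 (by norm_num)
    have hc : 0 < 1 / (8 * Real.exp 1 ^ 3) := by positivity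
    filter_upwards [(tendsto_pow_const_div_const_pow_of_one_lt 7 hr).eventually_le_const hc]
      with k hk
    rw [div_le_div_iff₀ (by positivity) (by positivity)] at hk
    linarith
  obtain ⟨K, hK⟩ := eventually_atTop.1 ((((E1.and E2).and E4).and E5).and (eventually_ge_atTop 2))
  refine ⟨K, fun k hk n hn => ?_⟩
  obtain ⟨⟨⟨⟨c1, c2⟩, c4⟩, c5⟩, hk2⟩ := hK k hk
  have hQ2 : (((a : ℝ) ^ ((1 : ℝ) / 4)) ^ k) ^ 2 = (a : ℝ) ^ ((k : ℝ) / 2) := by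
    rw [← pow_mul, ← Real.rpow_natCast, ← Real.rpow_mul hapos.le]
    congr 1; push_cast; ring
  have hQ4 : (((a : ℝ) ^ ((1 : ℝ) / 4)) ^ k) ^ 4 = (a : ℝ) ^ k := by
    rw [← pow_mul, ← Real.rpow_natCast, ← Real.rpow_mul hapos.le, ← Real.rpow_natCast]
    congr 1; push_cast; ring
  have h := one_size a k ha hk2 (((a : ℝ) ^ ((1 : ℝ) / 4)) ^ k) (by positivity) hQ4 c1 c2 c4 c5
  rw [hQ2] at h
  exact extend_omni a k _ n (by omega) (Nat.ceil_le.2 hn) h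
end

section
/- Let n ≥ k ≥ 2 and a ≥ 2 be integers and define φ(r,c) = C(k,r)·C(k,c)·C(n,k−r)·C(n,k−c)·a^(r·c) for integers 1 ≤ r,c ≤ k, where C denotes the binomial coefficient. Then for each fixed c with 1 ≤ c ≤ k, the function r ↦ φ(r,c) is monotone or unimodal on {1,…,k}: there exists r₀ with 1 ≤ r₀ ≤ k such that φ(r,c) ≤ φ(r+1,c) for all 1 ≤ r < r₀ and φ(r,c) ≥ φ(r+1,c) for all r₀ ≤ r < k. -/
/-- `φ(r,c) = C(k,r)·C(k,c)·C(n,k−r)·C(n,k−c)·a^(r·c)`. -/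
def phi (n k a r c : ℕ) : ℕ :=
  k.choose r * k.choose c * n.choose (k - r) * n.choose (k - c) * a ^ (r * c)

theorem phi_step (n k a r c : ℕ) (hn : k ≤ n) (hr : r < k) :
    phi n k a (r + 1) c * ((r + 1) * (n - k + r + 1)) =
      phi n k a r c * ((k - r) * (k - r) * a ^ c) := by
  obtain ⟨m, rfl⟩ : ∃ m, k = r + m + 1 := ⟨k - r - 1, by omega⟩
  obtain ⟨d, rfl⟩ := Nat.exists_eq_add_of_le hn
  have h1 := Nat.choose_succ_right_eq (r + m + 1) r
  have h2 := Nat.choose_succ_right_eq (r + m + 1 + d) m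
  have e1 : r + m + 1 - r = m + 1 := by omega
  have e2 : r + m + 1 - (r + 1) = m := by omega
  have e3 : r + m + 1 + d - m = d + r + 1 := by omega
  have e4 : r + m + 1 + d - (r + m + 1) = d := by omega
  have e5 : a ^ ((r + 1) * c) = a ^ (r * c) * a ^ c := by rw [← pow_add]; ring_nf
  rw [e1] at h1
  rw [e3] at h2
  unfold phi
  rw [e1, e2, e4, e5]
  generalize (r + m + 1).choose c = A
  generalize (r + m + 1 + d).choose (r + m + 1 - c) = B
  generalize a ^ (r * c) = X
  generalize a ^ c = Y
  generalize (r + m + 1).choose r = P at *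
  generalize (r + m + 1).choose (r + 1) = Q at *
  generalize (r + m + 1 + d).choose m = R at *
  generalize (r + m + 1 + d).choose (m + 1) = S at *
  calc Q * A * R * B * (X * Y) * ((r + 1) * (d + r + 1))
      = (Q * (r + 1)) * (R * (d + r + 1)) * (A * B * X * Y) := by ring
    _ = (P * (m + 1)) * (S * (m + 1)) * (A * B * X * Y) := by rw [h1, h2]
    _ = _ := by ring

theorem phi_unimodal_in_r (n k a : ℕ) (hk : 2 ≤ k) (hn : k ≤ n) (ha : 2 ≤ a) :
    ∀ c : ℕ, 1 ≤ c → c ≤ k →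
      ∃ r₀ : ℕ, 1 ≤ r₀ ∧ r₀ ≤ k ∧
        (∀ r : ℕ, 1 ≤ r → r < r₀ → phi n k a r c ≤ phi n k a (r + 1) c) ∧
        (∀ r : ℕ, r₀ ≤ r → r < k → phi n k a r c ≥ phi n k a (r + 1) c) := by
  intro c hc hck
  have hex : ∃ r, 1 ≤ r ∧ (k - r) * (k - r) * a ^ c ≤ (r + 1) * (n - k + r + 1) :=
    ⟨k, by omega, by simp⟩
  classical
  refine ⟨Nat.find hex, (Nat.find_spec hex).1, Nat.find_min' hex ⟨by omega, by simp⟩, ?_, ?_⟩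
  · intro r h1 hr
    have hrk : r < k := lt_of_lt_of_le hr (Nat.find_min' hex ⟨by omega, by simp⟩)
    have hlt : (r + 1) * (n - k + r + 1) ≤ (k - r) * (k - r) * a ^ c := by
      by_contra h
      exact Nat.find_min hex hr ⟨h1, by omega⟩
    have hs := phi_step n k a r c hn hrk
    refine Nat.le_of_mul_le_mul_right (c := (r + 1) * (n - k + r + 1)) ?_ (by positivity)
    rw [hs]
    exact Nat.mul_le_mul_left _ hlt
  · intro r hr hrk
    have hle : (k - r) * (k - r) * a ^ c ≤ (r + 1) * (n - k + r + 1) := by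
      have h0 := (Nat.find_spec hex).2
      generalize Nat.find hex = s at *
      calc (k - r) * (k - r) * a ^ c ≤ (k - s) * (k - s) * a ^ c := by gcongr
        _ ≤ _ := h0
        _ ≤ _ := by gcongr
    have hs := phi_step n k a r c hn hrk
    refine Nat.le_of_mul_le_mul_right (c := (r + 1) * (n - k + r + 1)) ?_ (by positivity)
    rw [hs]
    exact Nat.mul_le_mul_left _ hle
end

section
/- Let n ≥ k ≥ 2 and a ≥ 2 be integers and define φ(r,c) = C(k,r)·C(k,c)·C(n,k−r)·C(n,k−c)·a^(r·c). If 2·n ≥ k²·a + 2·k − 4 (i.e. n ≥ k²a/2 + k − 2), then φ(1,1) ≥ φ(2,1). -/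
theorem phi_one_one_ge_phi_two_one (n k a : ℕ) (hk : 2 ≤ k) (hn : k ≤ n) (ha : 2 ≤ a)
    (h : k ^ 2 * a + 2 * k - 4 ≤ 2 * n) :
    phi n k a 1 1 ≥ phi n k a 2 1 := by
  obtain ⟨m, rfl⟩ : ∃ m, k = m + 2 := ⟨k - 2, by omega⟩
  obtain ⟨d, rfl⟩ : ∃ d, n = m + d := ⟨n - m, by omega⟩
  have h1 : (m + 2) ^ 2 * a ≤ 2 * d := by
    generalize (m + 2) ^ 2 * a = X at *
    omega
  have h2 : (m + 1) ^ 2 * a ≤ 2 * d := le_trans (by gcongr; omega) h1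
  have h3 : (m + d).choose (m + 1) * (m + 1) = (m + d).choose m * d := by
    have := Nat.choose_succ_right_eq (m + d) m
    simpa using this
  have h4 : (m + 2).choose 2 * 2 = (m + 2) * (m + 1) := by
    have := Nat.choose_succ_right_eq (m + 2) 1
    simpa using this
  have key : (m + 2).choose 2 * a * (m + d).choose m ≤ (m + 2) * (m + d).choose (m + 1) := by
    have hp : 0 < 2 * (m + 1) := by positivity
    refine le_of_mul_le_mul_right ?_ hp
    calc (m + 2).choose 2 * a * (m + d).choose m * (2 * (m + 1))
        = ((m + 2).choose 2 * 2) * (a * (m + d).choose m * (m + 1)) := by ring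
      _ = (m + 2) * (m + d).choose m * ((m + 1) ^ 2 * a) := by rw [h4]; ring
      _ ≤ (m + 2) * (m + d).choose m * (2 * d) := by gcongr
      _ = (m + 2) * 2 * ((m + d).choose m * d) := by ring
      _ = _ := by rw [← h3]; ring
  have e1 : m + 2 - 1 = m + 1 := rfl
  have e2 : m + 2 - 2 = m := rfl
  unfold phi
  rw [e1, e2, Nat.choose_one_right]
  calc (m + 2).choose 2 * (m + 2) * (m + d).choose m * (m + d).choose (m + 1) * a ^ (2 * 1)
      = ((m + 2).choose 2 * a * (m + d).choose m) * ((m + 2) * (m + d).choose (m + 1) * a) := by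
        ring
    _ ≤ ((m + 2) * (m + d).choose (m + 1)) * ((m + 2) * (m + d).choose (m + 1) * a) := by gcongr
    _ = _ := by ring
end

section
/- Let n ≥ k ≥ 2 and a ≥ 2 be integers and define φ(r,c) = C(k,r)·C(k,c)·C(n,k−r)·C(n,k−c)·a^(r·c). If n·k ≤ a^k (i.e. n ≤ a^k/k), then φ(k,k) ≥ φ(k−1,k), and consequently φ(k−1,k) = max{ φ(r,k) : 1 ≤ r ≤ k−1 }. -/
theorem choose_succ_le_mul_aux (m j : ℕ) : m.choose (j + 1) ≤ m.choose j * m := by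
  have h := Nat.choose_succ_right_eq m j
  calc m.choose (j + 1) ≤ m.choose (j + 1) * (j + 1) := Nat.le_mul_of_pos_right _ (by omega)
    _ = m.choose j * (m - j) := h
    _ ≤ m.choose j * m := Nat.mul_le_mul_left _ (by omega)

theorem phi_step_aux (n k a r : ℕ) (h : n * k ≤ a ^ k) (hr : r + 1 ≤ k) :
    phi n k a r k ≤ phi n k a (r + 1) k := by
  unfold phi
  obtain ⟨j, rfl⟩ : ∃ j, k = r + 1 + j := ⟨k - (r + 1), by omega⟩
  have e1 : r + 1 + j - r = j + 1 := by omega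
  have e2 : r + 1 + j - (r + 1) = j := by omega
  have s1 : (r + 1 + j).choose r = (r + 1 + j).choose (j + 1) :=
    Nat.choose_symm_of_eq_add (by omega)
  have s2 : (r + 1 + j).choose (r + 1) = (r + 1 + j).choose j :=
    Nat.choose_symm_of_eq_add (by omega)
  rw [e1, e2, s1, s2, Nat.choose_self, Nat.sub_self, Nat.choose_zero_right]
  generalize hk : r + 1 + j = k at *
  have h1 := choose_succ_le_mul_aux k j
  have h2 := choose_succ_le_mul_aux n j
  calc k.choose (j + 1) * 1 * n.choose (j + 1) * 1 * a ^ (r * k)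
      ≤ (k.choose j * k) * 1 * (n.choose j * n) * 1 * a ^ (r * k) := by gcongr
    _ = k.choose j * n.choose j * a ^ (r * k) * (n * k) := by ring
    _ ≤ k.choose j * n.choose j * a ^ (r * k) * a ^ k := by gcongr
    _ = k.choose j * 1 * n.choose j * 1 * a ^ ((r + 1) * k) := by ring

theorem phi_max_on_boundary_column (n k a : ℕ) (hk : 2 ≤ k) (hn : k ≤ n) (ha : 2 ≤ a)
    (h : n * k ≤ a ^ k) :
    phi n k a k k ≥ phi n k a (k - 1) k ∧
    ∀ r : ℕ, 1 ≤ r → r ≤ k - 1 → phi n k a r k ≤ phi n k a (k - 1) k := by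
  constructor
  · have := phi_step_aux n k a (k - 1) h (by omega)
    rwa [show k - 1 + 1 = k by omega] at this
  · intro r _ hr
    have key : ∀ m, r ≤ m → m ≤ k → phi n k a r k ≤ phi n k a m k := by
      intro m hm
      induction m, hm using Nat.le_induction with
      | base => intro _; exact le_rfl
      | succ m hm ih => intro hmk; exact (ih (by omega)).trans (phi_step_aux n k a m h hmk)
    exact key (k - 1) hr (by omega)
end

section
/- Define φ(r,c) = C(k,r)·C(k,c)·C(n,k−r)·C(n,k−c)·a^(r·c). For every fixed integer a ≥ 2 there exists K such that for all integers k ≥ K and all integers n with k·a^(k/2)/e ≤ (n : ℝ) ≤ (k·a^(k/2)/e)·(1 + 2·log k/k) and n·k ≤ a^(k−1), one has φ(k−1,k) ≥ φ(r,c) for all integers r, c with 1 ≤ r, c ≤ k and r + c < 2k; i.e. φ(k−1,k) = max{ φ(r,c) : 1 ≤ r,c ≤ k, r+c < 2k }. -/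
lemma phi_aux_growth : ∃ K : ℕ, 3 ≤ K ∧ ∀ k : ℕ, K ≤ k → (k : ℝ) ^ 60 ≤ 2 ^ k := by
  have h := isLittleO_pow_const_const_pow_of_one_lt (R := ℝ) 60 (r := 2) (by norm_num)
  have h2 := h.bound (c := 1) one_pos
  obtain ⟨K, hK⟩ := Filter.eventually_atTop.1 h2
  refine ⟨max 3 K, le_max_left _ _, fun k hk => ?_⟩
  have := hK k (le_trans (le_max_right _ _) hk)
  simpa using this

lemma phi_aux_low (k n i : ℕ) (A : ℝ) (hA : 0 ≤ A) (hk : 3 ≤ k)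
    (hn : (n : ℝ) ≤ k * A / Real.exp 1 * (1 + 2 * Real.log k / k)) :
    (k.choose i : ℝ) * n.choose i ≤ ((k : ℝ) ^ 5) ^ i * A ^ i := by
  have hk3 : (3 : ℝ) ≤ k := by exact_mod_cast hk
  have hk0 : (0 : ℝ) < k := by linarith
  have hl : 1 + 2 * Real.log k / k ≤ 3 := by
    have h1 := Real.log_le_sub_one_of_pos hk0
    have : 2 * Real.log k / k ≤ 2 := by
      rw [div_le_iff₀ hk0]; linarith
    linarith
  have hn' : (n : ℝ) ≤ (k : ℝ) ^ 4 * A := by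
    have h1 : (k : ℝ) * A / Real.exp 1 ≤ k * A :=
      div_le_self (by positivity) (Real.one_le_exp (by norm_num))
    calc (n : ℝ) ≤ k * A / Real.exp 1 * (1 + 2 * Real.log k / k) := hn
      _ ≤ k * A / Real.exp 1 * 3 := mul_le_mul_of_nonneg_left hl (by positivity)
      _ ≤ k * A * k := by gcongr
      _ = (k : ℝ) ^ 2 * A := by ring
      _ ≤ (k : ℝ) ^ 4 * A := by
        gcongr
        · linarith
        · norm_num
  have c1 : (k.choose i : ℝ) ≤ (k : ℝ) ^ i := by exact_mod_cast Nat.choose_le_pow k i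
  have c2 : (n.choose i : ℝ) ≤ (n : ℝ) ^ i := by exact_mod_cast Nat.choose_le_pow n i
  calc (k.choose i : ℝ) * n.choose i ≤ (k : ℝ) ^ i * ((k : ℝ) ^ 4 * A) ^ i := by
        gcongr
        exact c2.trans (by gcongr)
    _ = ((k : ℝ) ^ 5) ^ i * A ^ i := by rw [← mul_pow, ← mul_pow]; ring

lemma phi_aux_high (k n i p : ℕ) (A : ℝ) (hA : 0 ≤ A) (hk : 3 ≤ k) (hip : i + p = k) (hp : 1 ≤ p)
    (hn : (n : ℝ) ≤ k * A / Real.exp 1 * (1 + 2 * Real.log k / k)) :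
    (k.choose i : ℝ) * n.choose i ≤ ((k : ℝ) ^ 5) ^ p * A ^ i := by
  have hk3 : (3 : ℝ) ≤ k := by exact_mod_cast hk
  have hk0 : (0 : ℝ) < k := by linarith
  have hlog : 0 ≤ Real.log k := Real.log_nonneg (by linarith)
  have hpw : (1 + 2 * Real.log k / k) ^ i ≤ (k : ℝ) ^ 2 := by
    calc (1 + 2 * Real.log k / k) ^ i ≤ (Real.exp (2 * Real.log k / k)) ^ i := by
          gcongr
          linarith [Real.add_one_le_exp (2 * Real.log k / k)]
      _ = Real.exp (i * (2 * Real.log k / k)) := by rw [Real.exp_nat_mul]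
      _ ≤ Real.exp (2 * Real.log k) := by
          apply Real.exp_le_exp.2
          have : (i : ℝ) ≤ k := by exact_mod_cast (by omega : i ≤ k)
          rw [← mul_div_assoc, div_le_iff₀ hk0]
          nlinarith
      _ = (k : ℝ) ^ 2 := by
          rw [show (2 : ℝ) * Real.log k = ((2 : ℕ) : ℝ) * Real.log k by norm_num,
            Real.exp_nat_mul, Real.exp_log hk0]
  have c1 : (k.choose i : ℝ) ≤ (k : ℝ) ^ p := by
    rw [Nat.choose_symm_of_eq_add (by omega : k = i + p)]
    exact_mod_cast Nat.choose_le_pow k p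
  have c2 : (n.choose i : ℝ) ≤ (n : ℝ) ^ i / (i.factorial : ℝ) := Nat.choose_le_pow_div i n
  have c3 : (k : ℝ) ^ i / (i.factorial : ℝ) / (Real.exp 1) ^ i ≤ (k : ℝ) ^ p := by
    have h1 := Real.pow_div_factorial_le_exp (k : ℝ) hk0.le i
    rw [div_le_iff₀ (by positivity)]
    refine h1.trans ?_
    have : Real.exp (k : ℝ) = Real.exp 1 ^ p * Real.exp 1 ^ i := by
      rw [← pow_add, ← Real.exp_nat_mul, add_comm p i, hip, mul_one]
    rw [this]
    gcongr
    linarith [Real.exp_one_lt_d9]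
  have hb : (0 : ℝ) ≤ 1 + 2 * Real.log k / k := by positivity
  calc (k.choose i : ℝ) * n.choose i
      ≤ (k : ℝ) ^ p * ((k * A / Real.exp 1 * (1 + 2 * Real.log k / k)) ^ i / (i.factorial : ℝ)) := by
        gcongr
        exact c2.trans (by gcongr)
    _ = (k : ℝ) ^ p * (((k : ℝ) ^ i / (i.factorial : ℝ) / (Real.exp 1) ^ i) *
          (1 + 2 * Real.log k / k) ^ i * A ^ i) := by
        rw [mul_pow, div_pow, mul_pow]; ring
    _ ≤ (k : ℝ) ^ p * ((k : ℝ) ^ p * (k : ℝ) ^ 2 * A ^ i) := by gcongr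
    _ = (k : ℝ) ^ (2 * p + 2) * A ^ i := by ring
    _ ≤ (k : ℝ) ^ (5 * p) * A ^ i := by
        gcongr
        · linarith
        · omega
    _ = ((k : ℝ) ^ 5) ^ p * A ^ i := by rw [pow_mul]

/-- combination: exponent inequality gives the bound -/
lemma phi_aux_comb (a k i j d e : ℕ) (ha : 2 ≤ a) (x y : ℝ) (hx0 : 0 ≤ x) (hy0 : 0 ≤ y)
    (hk : 3 ≤ k) (hik : i ≤ k) (hjk : j ≤ k)
    (hx : x ≤ ((k : ℝ) ^ 5) ^ d * ((a : ℝ) ^ ((k : ℝ) / 2)) ^ i)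
    (hy : y ≤ ((k : ℝ) ^ 5) ^ e * ((a : ℝ) ^ ((k : ℝ) / 2)) ^ j)
    (hg : (k : ℝ) ^ 5 ≤ (a : ℝ) ^ ((k : ℝ) / 12))
    (hE : (k : ℝ) * (d + e) / 12 + k * (i + j) / 2 + (k - i) * (k - j) ≤ k / 2 + (k - 1) * k) :
    x * y * (a : ℝ) ^ ((k - i) * (k - j)) ≤
      (a : ℝ) ^ ((k : ℝ) / 2) * (a : ℝ) ^ ((k - 1) * k) := by
  have ha1 : (1 : ℝ) ≤ a := by exact_mod_cast (by omega : 1 ≤ a)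
  have ha0 : (0 : ℝ) < a := by linarith
  calc x * y * (a : ℝ) ^ ((k - i) * (k - j))
      ≤ (((a : ℝ) ^ ((k : ℝ) / 12)) ^ d * ((a : ℝ) ^ ((k : ℝ) / 2)) ^ i) *
        (((a : ℝ) ^ ((k : ℝ) / 12)) ^ e * ((a : ℝ) ^ ((k : ℝ) / 2)) ^ j) *
        (a : ℝ) ^ ((k - i) * (k - j)) := by
        gcongr
        · exact hx.trans (by gcongr)
        · exact hy.trans (by gcongr)
    _ = (a : ℝ) ^ ((k : ℝ) * (d + e) / 12 + k * (i + j) / 2 + (k - i) * (k - j)) := by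
        simp only [← Real.rpow_natCast, ← Real.rpow_mul ha0.le, ← Real.rpow_add ha0]
        congr 1
        push_cast [hik, hjk]
        ring
    _ ≤ (a : ℝ) ^ ((k : ℝ) / 2 + (k - 1) * k) := Real.rpow_le_rpow_of_exponent_le ha1 hE
    _ = _ := by
        simp only [← Real.rpow_natCast, ← Real.rpow_add ha0]
        congr 1
        push_cast [(by omega : 1 ≤ k)]
        ring

/-- both coordinates near the same corner -/
lemma phi_aux_corner (k d e : ℕ) (hk : 3 ≤ k) (hd : 2 * d ≤ k) (he : 2 * e ≤ k) (h : 2 ≤ d + e) :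
    (k : ℝ) * (d + e) / 12 + k / 2 ≤ k * (d + e) / 2 - d * e := by
  have hk' : (3 : ℝ) ≤ k := by exact_mod_cast hk
  have hd' : (2 : ℝ) * d ≤ k := by exact_mod_cast hd
  have he' : (2 : ℝ) * e ≤ k := by exact_mod_cast he
  have d0 : (0 : ℝ) ≤ d := by positivity
  have e0 : (0 : ℝ) ≤ e := by positivity
  rcases Nat.lt_or_ge (d + e) 3 with h3 | h3
  · have : (d = 0 ∧ e = 2) ∨ (d = 1 ∧ e = 1) ∨ (d = 2 ∧ e = 0) := by omega
    rcases this with ⟨rfl, rfl⟩ | ⟨rfl, rfl⟩ | ⟨rfl, rfl⟩ <;> push_cast <;> linarith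
  · have h3' : (3 : ℝ) ≤ d + e := by exact_mod_cast h3
    nlinarith [mul_nonneg d0 (sub_nonneg.2 he'), mul_nonneg e0 (sub_nonneg.2 hd'),
      mul_nonneg (by linarith : (0 : ℝ) ≤ k) (sub_nonneg.2 h3')]

lemma phi_aux_mixed (k i q : ℝ) (hk : 3 ≤ k) (hi : 2 * i ≤ k) (hq : 2 * q ≤ k) :
    k * (i + q) / 12 + k * (i + (k - q)) / 2 + (k - i) * q ≤ k / 2 + (k - 1) * k := by
  nlinarith [mul_nonneg (sub_nonneg.2 hi) (sub_nonneg.2 hq)]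

theorem phi_global_max (a : ℕ) (ha : 2 ≤ a) :
    ∃ K : ℕ, ∀ k : ℕ, K ≤ k → ∀ n : ℕ,
      (k : ℝ) * (a : ℝ) ^ ((k : ℝ) / 2) / Real.exp 1 ≤ (n : ℝ) →
      (n : ℝ) ≤ (k : ℝ) * (a : ℝ) ^ ((k : ℝ) / 2) / Real.exp 1 *
        (1 + 2 * Real.log k / k) →
      n * k ≤ a ^ (k - 1) →
      ∀ r c : ℕ, 1 ≤ r → r ≤ k → 1 ≤ c → c ≤ k → r + c < 2 * k →
        phi n k a r c ≤ phi n k a (k - 1) k := by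
  obtain ⟨K, hK3, hK⟩ := phi_aux_growth
  refine ⟨K, fun k hKk n hn1 hn2 _ r c hr hrk hc hck hrc => ?_⟩
  have hk : 3 ≤ k := hK3.trans hKk
  have hk3 : (3 : ℝ) ≤ k := by exact_mod_cast hk
  have ha1 : (1 : ℝ) ≤ a := by exact_mod_cast (by omega : 1 ≤ a)
  have ha2 : (2 : ℝ) ≤ a := by exact_mod_cast ha
  have ha0 : (0 : ℝ) < a := by linarith
  have hg : (k : ℝ) ^ 5 ≤ (a : ℝ) ^ ((k : ℝ) / 12) := by
    refine le_of_pow_le_pow_left₀ (n := 12) (by norm_num) (by positivity) ?_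
    rw [← pow_mul, ← Real.rpow_natCast ((a : ℝ) ^ ((k : ℝ) / 12)), ← Real.rpow_mul ha0.le]
    rw [show (k : ℝ) / 12 * ((12 : ℕ) : ℝ) = (k : ℝ) by push_cast; ring, Real.rpow_natCast]
    exact (hK k hKk).trans (by gcongr)
  have hA : (0 : ℝ) ≤ (a : ℝ) ^ ((k : ℝ) / 2) := by positivity
  obtain ⟨i, hi⟩ : ∃ i, i = k - r := ⟨_, rfl⟩
  obtain ⟨j, hj⟩ : ∃ j, j = k - c := ⟨_, rfl⟩
  obtain rfl : r = k - i := by omega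
  obtain rfl : c = k - j := by omega
  have hik : i ≤ k := by omega
  have hjk : j ≤ k := by omega
  have hki : k - (k - i) = i := by omega
  have hkj : k - (k - j) = j := by omega
  have htgt : phi n k a (k - 1) k = k * n * a ^ ((k - 1) * k) := by
    unfold phi
    rw [show k - (k - 1) = 1 by omega, Nat.choose_symm (by omega : 1 ≤ k)]
    simp
  have hsrc : phi n k a (k - i) (k - j) =
      (k.choose i * n.choose i) * (k.choose j * n.choose j) * a ^ ((k - i) * (k - j)) := by
    unfold phi
    rw [hki, hkj, Nat.choose_symm hik, Nat.choose_symm hjk]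
    ring
  rw [hsrc, htgt]
  by_cases h1 : i + j = 1
  · have : (i = 0 ∧ j = 1) ∨ (i = 1 ∧ j = 0) := by omega
    rcases this with ⟨rfl, rfl⟩ | ⟨rfl, rfl⟩
    · simp [mul_comm]
    · simp
  have h2 : 2 ≤ i + j := by omega
  have hT : (a : ℝ) ^ ((k : ℝ) / 2) * (a : ℝ) ^ ((k - 1) * k) ≤ k * n * (a : ℝ) ^ ((k - 1) * k) := by
    gcongr
    have he : Real.exp 1 ≤ 3 := by linarith [Real.exp_one_lt_d9]
    rw [div_le_iff₀ (Real.exp_pos 1)] at hn1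
    have hn0 : (0 : ℝ) ≤ n := by positivity
    nlinarith [mul_le_mul_of_nonneg_left he hn0, mul_nonneg hA (sub_nonneg.2 hk3),
      mul_nonneg hn0 (sub_nonneg.2 hk3)]
  suffices hmain : ((k.choose i : ℝ) * n.choose i) * ((k.choose j : ℝ) * n.choose j) *
      (a : ℝ) ^ ((k - i) * (k - j)) ≤
      (a : ℝ) ^ ((k : ℝ) / 2) * (a : ℝ) ^ ((k - 1) * k) by
    exact_mod_cast hmain.trans hT
  have li := phi_aux_low k n i _ hA hk hn2
  have lj := phi_aux_low k n j _ hA hk hn2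
  obtain ⟨p, hp⟩ : ∃ p, i + p = k := ⟨k - i, by omega⟩
  obtain ⟨q, hq⟩ : ∃ q, j + q = k := ⟨k - j, by omega⟩
  have ui := phi_aux_high k n i p _ hA hk hp (by omega) hn2
  have uj := phi_aux_high k n j q _ hA hk hq (by omega) hn2
  have hp' : (i : ℝ) + p = k := by exact_mod_cast hp
  have hq' : (j : ℝ) + q = k := by exact_mod_cast hq
  have x0 : (0 : ℝ) ≤ (k.choose i : ℝ) * n.choose i := by positivity
  have y0 : (0 : ℝ) ≤ (k.choose j : ℝ) * n.choose j := by positivity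
  rcases le_total (2 * i) k with ci | ci <;> rcases le_total (2 * j) k with cj | cj
  · refine phi_aux_comb a k i j i j ha _ _ x0 y0 hk hik hjk li lj hg ?_
    linarith [phi_aux_corner k i j hk ci cj h2]
  · refine phi_aux_comb a k i j i q ha _ _ x0 y0 hk hik hjk li uj hg ?_
    have c1 : 2 * (i : ℝ) ≤ k := by exact_mod_cast ci
    have c2 : 2 * (q : ℝ) ≤ k := by exact_mod_cast (by omega : 2 * q ≤ k)
    have := phi_aux_mixed k i q hk3 c1 c2
    have e2 : (j : ℝ) = k - q := by linarith
    rw [e2]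
    linarith
  · refine phi_aux_comb a k i j p j ha _ _ x0 y0 hk hik hjk ui lj hg ?_
    have c1 : 2 * (j : ℝ) ≤ k := by exact_mod_cast cj
    have c2 : 2 * (p : ℝ) ≤ k := by exact_mod_cast (by omega : 2 * p ≤ k)
    have := phi_aux_mixed k j p hk3 c1 c2
    have e1 : (i : ℝ) = k - p := by linarith
    rw [e1]
    linarith
  · refine phi_aux_comb a k i j p q ha _ _ x0 y0 hk hik hjk ui uj hg ?_
    have := phi_aux_corner k p q hk (by omega) (by omega) (by omega)
    have e1 : (i : ℝ) = k - p := by linarith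
    have e2 : (j : ℝ) = k - q := by linarith
    rw [e1, e2]
    linarith
end

section
/- Fix an integer a ≥ 2 and a real constant r > 0, and let H = 1 + 1/2 + ⋯ + 1/a = Σ_{j=1}^{a} 1/j. For each integer k ≥ 1 let n = ⌊r·k⌋ and let p_k be the proportion of sequences s : Fin n → Fin a that are k-omni, i.e. p_k = (number of k-omni sequences of length n over an a-letter alphabet) / a^n. If r < a·H then p_k → 0 as k → ∞, and if r > a·H then p_k → 1 as k → ∞. -/
open Filter

/-- A sequence `s : Fin n → Fin a` is `k`-omni if it contains every length-`k`
word over the alphabet as a (not necessarily contiguous) subsequence. -/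
def IsKOmni (a k : ℕ) {n : ℕ} (s : Fin n → Fin a) : Prop :=
  ∀ w : Fin k → Fin a, ∃ ρ : Fin k → Fin n, StrictMono ρ ∧ ∀ i, w i = s (ρ i)

/-- State of the current coupon-collector round after reading `x`. -/
def nxt {a : ℕ} (S : Finset (Fin a)) (x : Fin a) : Finset (Fin a) :=
  if insert x S = Finset.univ then ∅ else insert x S

/-- Number of completed rounds. -/
def rounds {a : ℕ} : Finset (Fin a) → List (Fin a) → ℕ
  | _, [] => 0
  | S, x :: l => (if insert x S = Finset.univ then 1 else 0) + rounds (nxt S x) l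

/-- Increment of the potential. -/
noncomputable def inc {a : ℕ} (S : Finset (Fin a)) (x : Fin a) : ℝ :=
  if x ∈ S then 0 else (a : ℝ) / (a - S.card)

/-- Total increment of the potential. -/
noncomputable def pot {a : ℕ} : Finset (Fin a) → List (Fin a) → ℝ
  | _, [] => 0
  | S, x :: l => inc S x + pot (nxt S x) l

/-- Potential of a partial round. -/
noncomputable def gg (a j : ℕ) : ℝ := ∑ i ∈ Finset.range j, (a : ℝ) / (a - i)

lemma nxt_ne_univ {a : ℕ} (ha : 2 ≤ a) (S : Finset (Fin a)) (x : Fin a) :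
    nxt S x ≠ Finset.univ := by
  unfold nxt
  split_ifs with h
  · intro h2
    have := congrArg Finset.card h2
    simp at this
    omega
  · exact h

lemma card_lt_of_ne {a : ℕ} {S : Finset (Fin a)} (h : S ≠ Finset.univ) : S.card < a := by
  have := Finset.card_lt_card (Finset.ssubset_univ_iff.mpr h)
  simpa using this

lemma rounds_iff {a : ℕ} (ha : 2 ≤ a) (l : List (Fin a)) :
    ∀ (S : Finset (Fin a)) (_ : S ≠ Finset.univ) (k : ℕ),
      k + 1 ≤ rounds S l ↔ ∀ w : List (Fin a), w.length = k → ∀ y ∉ S, (y :: w).Sublist l := by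
  induction l with
  | nil =>
    intro S hS k
    obtain ⟨y, hy⟩ : ∃ y, y ∉ S := by
      by_contra! h
      exact hS (Finset.eq_univ_iff_forall.mpr h)
    constructor
    · intro h; simp [rounds] at h
    · intro h
      have := h (List.replicate k y) (by simp) y hy
      simp at this
  | cons x l ih =>
    intro S hS k
    have IH := ih (nxt S x) (nxt_ne_univ ha S x)
    have hn := nxt_ne_univ ha S x
    by_cases h : insert x S = Finset.univ
    · have hx : ∀ y, y ∉ S → y = x := by
        intro y hy
        have : y ∈ insert x S := by rw [h]; simp
        simpa [hy] using this
      have hxS : x ∉ S := by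
        intro hx; rw [Finset.insert_eq_of_mem hx] at h; exact hS h
      have e : nxt S x = ∅ := by simp [nxt, h]
      rw [e] at IH
      have e2 : rounds S (x :: l) = 1 + rounds ∅ l := by simp [rounds, h, e]
      rw [e2]
      have key : k ≤ rounds ∅ l ↔ ∀ w : List (Fin a), w.length = k → w.Sublist l := by
        cases k with
        | zero =>
          simp only [Nat.zero_le, true_iff]
          intro w hw
          rw [List.length_eq_zero_iff] at hw
          simp [hw]
        | succ k =>
          rw [IH k]
          constructor
          · intro H w hw
            cases w with
            | nil => simp at hw
            | cons y w => exact H w (by simpa using hw) y (by simp)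
          · intro H w hw y _
            exact H _ (by simp [hw])
      constructor
      · intro H w hw y hy
        rw [hx y hy]
        exact List.cons_sublist_cons.mpr (key.mp (by omega) w hw)
      · intro H
        have := key.mpr (fun w hw => List.cons_sublist_cons.mp (H w hw x hxS))
        omega
    · have e : nxt S x = insert x S := by simp [nxt, h]
      have e2 : rounds S (x :: l) = rounds (insert x S) l := by simp [rounds, h, e]
      rw [e] at IH hn
      rw [e2, IH k]
      constructor
      · intro H w hw y hy
        by_cases hyx : y = x
        · obtain ⟨z, hz⟩ : ∃ z, z ∉ insert x S := by
            by_contra! h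
            exact hn (Finset.eq_univ_iff_forall.mpr h)
          rw [hyx]
          exact List.cons_sublist_cons.mpr ((List.sublist_cons_self z w).trans (H w hw z hz))
        · exact (H w hw y (by simp [hyx, hy])).trans (List.sublist_cons_self _ _)
      · intro H w hw y hy
        simp only [Finset.mem_insert, not_or] at hy
        have := H w hw y hy.2
        rcases List.cons_sublist_cons'.mp this with h | h
        · exact h
        · exact absurd h.1 hy.1

lemma omni_iff_list {a k n : ℕ} (s : Fin n → Fin a) :
    IsKOmni a k s ↔ ∀ w : List (Fin a), w.length = k → w.Sublist (List.ofFn s) := by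
  constructor
  · intro h w hw
    subst hw
    obtain ⟨ρ, hρ, h2⟩ := h w.get
    rw [List.sublist_iff_exists_fin_orderEmbedding_get_eq]
    refine ⟨OrderEmbedding.ofStrictMono (fun i => Fin.cast (by simp) (ρ i)) ?_, ?_⟩
    · intro i j hij
      exact hρ hij
    · intro i
      rw [h2 i]
      simp
      rfl
  · intro h w
    have := h (List.ofFn w) (by simp)
    rw [List.sublist_iff_exists_fin_orderEmbedding_get_eq] at this
    obtain ⟨f, hf⟩ := this
    refine ⟨fun i => Fin.cast (by simp) (f (Fin.cast (by simp) i)), ?_, ?_⟩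
    · intro i j hij
      have : f (Fin.cast (by simp) i) < f (Fin.cast (by simp) j) := f.strictMono hij
      exact this
    · intro i
      have := hf (Fin.cast (by simp) i)
      simp only [List.get_ofFn] at this
      exact this

lemma omni_iff {a k n : ℕ} (ha : 2 ≤ a) (s : Fin n → Fin a) :
    IsKOmni a k s ↔ k ≤ rounds ∅ (List.ofFn s) := by
  rw [omni_iff_list]
  have hne : (∅ : Finset (Fin a)) ≠ Finset.univ := by
    intro h2
    have := congrArg Finset.card h2
    simp at this
    omega
  cases k with
  | zero =>
    simp only [Nat.zero_le, iff_true]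
    intro w hw
    rw [List.length_eq_zero_iff] at hw
    simp [hw]
  | succ k =>
    rw [rounds_iff ha _ _ hne]
    constructor
    · intro H w hw y _
      exact H _ (by simp [hw])
    · intro H w hw
      cases w with
      | nil => simp at hw
      | cons y w => exact H w (by simpa using hw) y (by simp)

lemma gg_nonneg {a j : ℕ} (h : j ≤ a) : 0 ≤ gg a j := by
  unfold gg
  refine Finset.sum_nonneg fun i hi => ?_
  have : i < a := lt_of_lt_of_le (Finset.mem_range.mp hi) h
  have : (i : ℝ) < a := by exact_mod_cast this
  exact div_nonneg (by positivity) (by linarith)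

lemma gg_le {a j : ℕ} (h : j ≤ a) : gg a j ≤ gg a a := by
  unfold gg
  refine Finset.sum_le_sum_of_subset_of_nonneg (by simpa using h) fun i hi _ => ?_
  have : (i : ℝ) < a := by exact_mod_cast Finset.mem_range.mp hi
  exact div_nonneg (by positivity) (by linarith)

lemma gg_self (a : ℕ) : gg a a = a * ∑ j ∈ Finset.Icc 1 a, (1 : ℝ) / j := by
  unfold gg
  rw [← Finset.sum_range_reflect, Finset.mul_sum, Finset.range_eq_Ico]
  rw [show Finset.Icc 1 a = Finset.Ico (0 + 1) (a + 1) by ext; simp,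
    ← Finset.sum_Ico_add' (fun j : ℕ => (a : ℝ) * (1 / (j : ℝ)))]
  refine Finset.sum_congr rfl fun i hi => ?_
  simp only [Finset.mem_Ico] at hi
  have e : ((a - 1 - i : ℕ) : ℝ) = a - 1 - i := by
    rw [Nat.cast_sub (by omega), Nat.cast_sub (by omega)]; simp
  rw [e]
  push_cast
  rw [show (a : ℝ) - (a - 1 - i) = i + 1 by ring]
  ring

lemma pot_bounds {a : ℕ} (ha : 2 ≤ a) (l : List (Fin a)) :
    ∀ (S : Finset (Fin a)) (_ : S ≠ Finset.univ),
      rounds S l * gg a a ≤ pot S l + gg a S.card ∧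
      pot S l + gg a S.card ≤ (rounds S l + 1) * gg a a := by
  induction l with
  | nil =>
    intro S hS
    have := card_lt_of_ne hS
    simp only [rounds, pot]
    have h1 := gg_nonneg this.le
    have h2 := gg_le this.le
    constructor <;> push_cast <;> linarith
  | cons x l ih =>
    intro S hS
    have IH := ih (nxt S x) (nxt_ne_univ ha S x)
    by_cases hx : x ∈ S
    · have e : insert x S = S := Finset.insert_eq_of_mem hx
      have e2 : nxt S x = S := by simp [nxt, e, hS]
      rw [e2] at IH
      simpa [rounds, pot, inc, hx, e2, hS] using IH
    · have hc : (insert x S).card = S.card + 1 := Finset.card_insert_of_notMem hx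
      have hg : gg a (S.card + 1) = gg a S.card + inc S x := by
        simp [gg, inc, hx, Finset.sum_range_succ]
      by_cases h : insert x S = Finset.univ
      · have e2 : nxt S x = ∅ := by simp [nxt, h]
        rw [h] at hc
        simp only [Finset.card_univ, Fintype.card_fin] at hc
        rw [← hc] at hg
        rw [e2] at IH
        simp only [Finset.card_empty] at IH
        have g0 : gg a 0 = 0 := by simp [gg]
        rw [g0] at IH
        simp only [rounds, pot, h, e2, if_true]
        push_cast
        constructor <;> nlinarith [IH.1, IH.2]
      · have e2 : nxt S x = insert x S := by simp [nxt, h]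
        rw [e2, hc, hg] at IH
        simp only [rounds, pot, h, e2, if_false]
        push_cast
        constructor <;> linarith [IH.1, IH.2]

lemma sum_inc {a : ℕ} (S : Finset (Fin a)) (hS : S ≠ Finset.univ) :
    ∑ x, (inc S x - 1) = 0 := by
  have h := card_lt_of_ne hS
  have h' : (S.card : ℝ) < a := by exact_mod_cast h
  have h3 : (a : ℝ) - S.card ≠ 0 := by linarith
  have : ∑ x, inc S x = ∑ x ∈ Sᶜ, (a : ℝ) / (a - S.card) := by
    have e : ∀ x, inc S x = if x ∈ Sᶜ then (a : ℝ) / (a - S.card) else 0 := by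
      intro x; by_cases hx : x ∈ S <;> simp [inc, hx]
    simp only [e]
    rw [Finset.sum_ite_mem]; simp
  rw [Finset.sum_sub_distrib, this]
  simp only [Finset.sum_const, Finset.card_compl, Fintype.card_fin, nsmul_eq_mul,
    Finset.card_univ, mul_one]
  rw [Nat.cast_sub h.le]
  field_simp
  ring

lemma inc_sq {a : ℕ} (S : Finset (Fin a)) (hS : S ≠ Finset.univ) (x : Fin a) :
    (inc S x - 1) ^ 2 ≤ (a : ℝ) ^ 2 := by
  have h := card_lt_of_ne hS
  have h' : (S.card : ℝ) + 1 ≤ a := by exact_mod_cast h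
  have hc : (0 : ℝ) ≤ S.card := by positivity
  have ha : (1 : ℝ) ≤ a := by linarith
  have h0 : 0 ≤ inc S x := by
    unfold inc; split_ifs
    · exact le_rfl
    · exact div_nonneg (by linarith) (by linarith)
  have h1 : inc S x ≤ a := by
    unfold inc; split_ifs
    · linarith
    · exact div_le_self (by linarith) (by linarith)
  apply sq_le_sq'
  · linarith
  · linarith

lemma second_moment {a : ℕ} (ha : 2 ≤ a) (n : ℕ) :
    ∀ (S : Finset (Fin a)) (_ : S ≠ Finset.univ) (c : ℝ),
      ∑ s : Fin n → Fin a, (pot S (List.ofFn s) - n + c) ^ 2 ≤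
        (a : ℝ) ^ n * (c ^ 2 + n * (a : ℝ) ^ 2) := by
  induction n with
  | zero => intro S hS c; simp [pot]
  | succ n ih =>
    intro S hS c
    rw [← (Fin.consEquiv (fun _ : Fin (n + 1) => Fin a)).sum_comp, Fintype.sum_prod_type]
    have step : ∀ x : Fin a, ∑ s : Fin n → Fin a,
        (pot S (List.ofFn (Fin.consEquiv (fun _ : Fin (n + 1) => Fin a) (x, s)))
          - (n + 1 : ℕ) + c) ^ 2 ≤
        (a : ℝ) ^ n * ((c + (inc S x - 1)) ^ 2 + n * (a : ℝ) ^ 2) := by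
      intro x
      refine le_trans (le_of_eq ?_) (ih (nxt S x) (nxt_ne_univ ha S x) (c + (inc S x - 1)))
      refine Finset.sum_congr rfl fun s _ => ?_
      have : List.ofFn (Fin.consEquiv (fun _ : Fin (n + 1) => Fin a) (x, s))
          = x :: List.ofFn s := by
        simp [Fin.consEquiv, List.ofFn_succ]
      rw [this]
      simp only [pot]
      push_cast
      ring
    refine (Finset.sum_le_sum fun x _ => step x).trans ?_
    rw [← Finset.mul_sum, pow_succ (a : ℝ) n, mul_assoc]
    refine mul_le_mul_of_nonneg_left ?_ (by positivity)
    have e : ∀ x : Fin a, (c + (inc S x - 1)) ^ 2 + n * (a : ℝ) ^ 2 ≤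
        (c ^ 2 + (n + 1) * (a : ℝ) ^ 2) + 2 * c * (inc S x - 1) := by
      intro x
      nlinarith [inc_sq S hS x]
    refine (Finset.sum_le_sum fun x _ => e x).trans ?_
    rw [Finset.sum_add_distrib, ← Finset.mul_sum, sum_inc S hS]
    simp
    linarith

lemma chebyshev {a : ℕ} (ha : 2 ≤ a) (n : ℕ) (t : ℝ) (ht : 0 < t)
    (P : (Fin n → Fin a) → Prop)
    (hP : ∀ s, P s → t ≤ |pot ∅ (List.ofFn s) - n|) :
    (Nat.card {s // P s} : ℝ) / (a : ℝ) ^ n ≤ n * (a : ℝ) ^ 2 / t ^ 2 := by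
  classical
  have hne : (∅ : Finset (Fin a)) ≠ Finset.univ := by
    intro h2
    have := congrArg Finset.card h2
    simp at this
    omega
  have h := second_moment ha n ∅ hne 0
  have hapos : (0 : ℝ) < a := by positivity
  rw [div_le_div_iff₀ (by positivity) (by positivity)]
  have h2 : (Nat.card {s // P s} : ℝ) * t ^ 2 ≤
      ∑ s : Fin n → Fin a, (pot ∅ (List.ofFn s) - n + 0) ^ 2 := by
    rw [Nat.card_eq_fintype_card, Fintype.card_subtype, ← nsmul_eq_mul]
    refine (Finset.card_nsmul_le_sum (Finset.univ.filter P) 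
      (fun s => (pot ∅ (List.ofFn s) - n + 0) ^ 2) _ ?_).trans ?_
    · intro s hs
      have := hP s (Finset.mem_filter.mp hs).2
      rw [add_zero, ← sq_abs (pot ∅ (List.ofFn s) - n)]
      exact pow_le_pow_left₀ ht.le this 2
    · exact Finset.sum_le_sum_of_subset_of_nonneg (Finset.filter_subset _ _)
        fun _ _ _ => sq_nonneg _
  refine (h2.trans h).trans (le_of_eq ?_)
  ring

theorem omni_threshold (a : ℕ) (ha : 2 ≤ a) (r : ℝ) (hr : 0 < r)
    (H : ℝ) (hH : H = ∑ j ∈ Finset.Icc 1 a, (1 : ℝ) / j)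
    (p : ℕ → ℝ)
    (hp : ∀ k : ℕ,
      p k = (Nat.card {s : Fin ⌊r * k⌋₊ → Fin a // IsKOmni a k s} : ℝ) /
        (a : ℝ) ^ (⌊r * k⌋₊)) :
    (r < a * H → Tendsto p atTop (nhds 0)) ∧
    (r > a * H → Tendsto p atTop (nhds 1)) := by
  have hg : gg a a = a * H := by rw [hH, gg_self]
  have hgn : 0 ≤ gg a a := gg_nonneg le_rfl
  have hne : (∅ : Finset (Fin a)) ≠ Finset.univ := by
    intro h2
    have := congrArg Finset.card h2
    simp at this
    omega
  have g0 : gg a 0 = 0 := by simp [gg]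
  have hb := fun (n : ℕ) (s : Fin n → Fin a) => pot_bounds ha (List.ofFn s) ∅ hne
  simp only [Finset.card_empty, g0, add_zero] at hb
  have hfl : ∀ k : ℕ, (⌊r * k⌋₊ : ℝ) ≤ r * k := fun k => Nat.floor_le (by positivity)
  have hfl2 : ∀ k : ℕ, r * k < (⌊r * k⌋₊ : ℝ) + 1 := fun k => Nat.lt_floor_add_one _
  have lim : ∀ C : ℝ, Tendsto (fun k : ℕ => C / (k : ℝ)) atTop (nhds 0) :=
    fun C => tendsto_const_div_atTop_nhds_zero_nat C
  have main : ∀ (c : ℝ) (_ : 0 < c) (k : ℕ) (_ : 0 < k)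
      (P : (Fin ⌊r * k⌋₊ → Fin a) → Prop)
      (_ : ∀ s, P s → c * k ≤ |pot ∅ (List.ofFn s) - (⌊r * k⌋₊ : ℝ)|),
      (Nat.card {s // P s} : ℝ) / (a : ℝ) ^ ⌊r * k⌋₊ ≤ (r * (a : ℝ) ^ 2 / c ^ 2) / k := by
    intro c hc k hk P hP
    have hk' : (0 : ℝ) < k := by exact_mod_cast hk
    refine (chebyshev ha _ (c * k) (by positivity) P hP).trans ?_
    have : (r * (a : ℝ) ^ 2 / c ^ 2) / k = (r * k) * (a : ℝ) ^ 2 / (c * k) ^ 2 := by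
      field_simp
    rw [this]
    gcongr
    exact hfl k
  constructor
  · intro hlt
    rw [← hg] at hlt
    refine squeeze_zero' (Eventually.of_forall fun k => ?_) ?_
      (lim (r * (a : ℝ) ^ 2 / (gg a a - r) ^ 2))
    · rw [hp]; positivity
    · filter_upwards [eventually_gt_atTop 0] with k hk
      rw [hp]
      refine main (gg a a - r) (by linarith) k hk _ fun s hs => ?_
      rw [omni_iff ha] at hs
      have hs' : (k : ℝ) ≤ rounds ∅ (List.ofFn s) := by exact_mod_cast hs
      refine le_trans ?_ (le_abs_self _)
      have h1 := (hb _ s).1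
      have h2 := mul_le_mul_of_nonneg_right hs' hgn
      have h3 := hfl k
      linarith
  · intro hgt
    rw [← hg] at hgt
    set c := (r - gg a a) / 2 with hc
    have hcpos : 0 < c := by rw [hc]; linarith
    have hq : Tendsto (fun k => 1 - p k) atTop (nhds 0) := by
      have hcompl : ∀ k, 1 - p k =
          (Nat.card {s : Fin ⌊r * k⌋₊ → Fin a // ¬ IsKOmni a k s} : ℝ) /
            (a : ℝ) ^ (⌊r * k⌋₊) := by
        intro k
        classical
        have e := Fintype.card_subtype_compl
          (fun s : Fin ⌊r * k⌋₊ → Fin a => IsKOmni a k s)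
        have le := Fintype.card_subtype_le (fun s : Fin ⌊r * k⌋₊ → Fin a => IsKOmni a k s)
        have hapos : (0 : ℝ) < (a : ℝ) ^ (⌊r * k⌋₊) := by positivity
        rw [hp, Nat.card_eq_fintype_card, Nat.card_eq_fintype_card, e, Nat.cast_sub le]
        simp only [Fintype.card_fun, Fintype.card_fin, Nat.cast_pow]
        field_simp
      refine squeeze_zero' (Eventually.of_forall fun k => ?_) ?_
        (lim (r * (a : ℝ) ^ 2 / c ^ 2))
      · rw [hcompl]; positivity
      · filter_upwards [eventually_gt_atTop 0, eventually_ge_atTop ⌈1 / c⌉₊] with k hk hk2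
        rw [hcompl]
        refine main c hcpos k hk _ fun s hs => ?_
        rw [omni_iff ha, not_le] at hs
        have hs' : (rounds ∅ (List.ofFn s) : ℝ) + 1 ≤ k := by exact_mod_cast hs
        have hk3 : 1 / c ≤ k := Nat.ceil_le.mp hk2
        rw [div_le_iff₀ hcpos] at hk3
        refine le_trans ?_ (neg_le_abs _)
        have h1 := (hb _ s).2
        have h2 := mul_le_mul_of_nonneg_right hs' hgn
        have h3 := hfl2 k
        have h4 : c * k + c * k = r * k - gg a a * k := by rw [hc]; ring
        linarith
    have := hq.const_sub 1
    simpa using this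
end

section
/- A sequence s : Fin n → Fin a over the alphabet {1,…,a} is k-omni if and only if it contains at least k disjoint coupon collections; precisely, s contains every sequence w : Fin k → Fin a as a subsequence if and only if there exist indices 0 = t₀ < t₁ < ⋯ < t_k ≤ n such that for each i ∈ {1,…,k}, the restriction of s to the positions in the interval (t_{i−1}, t_i] takes every value in the alphabet {1,…,a}. -/
theorem omni_aux (n a : ℕ) (ha : 1 ≤ a) (s : Fin n → Fin a) (k : ℕ) :
    ∀ m : ℕ, m ≤ n →
      (∀ w : Fin k → Fin a, ∃ ρ : Fin k → Fin n, StrictMono ρ ∧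
        (∀ i, m ≤ (ρ i : ℕ)) ∧ ∀ i, w i = s (ρ i)) →
      ∃ t : Fin (k + 1) → ℕ, t 0 = m ∧ StrictMono t ∧ t (Fin.last k) ≤ n ∧
        ∀ i : Fin k, ∀ v : Fin a, ∃ j : Fin n,
          t i.castSucc ≤ (j : ℕ) ∧ (j : ℕ) < t i.succ ∧ s j = v := by
  induction k with
  | zero =>
    intro m hm _
    refine ⟨fun _ => m, rfl, ?_, hm, fun i => i.elim0⟩
    intro i j hij
    exact absurd hij (by omega)
  | succ k ih =>
    intro m hm h
    classical
    let P : ℕ → Prop := fun t => ∀ v : Fin a, ∃ j : Fin n, m ≤ (j : ℕ) ∧ (j : ℕ) < t ∧ s j = v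
    have hPn : P n := by
      intro v
      obtain ⟨ρ, _, h2, h3⟩ := h (fun _ => v)
      exact ⟨ρ 0, h2 0, (ρ 0).isLt, (h3 0).symm⟩
    have hex : ∃ t, P t := ⟨n, hPn⟩
    obtain ⟨T, hT, hmin⟩ : ∃ T, P T ∧ ∀ u, u < T → ¬ P u :=
      ⟨Nat.find hex, Nat.find_spec hex, fun u hu => Nat.find_min hex hu⟩
    have hTn : T ≤ n := by
      by_contra hc
      exact hmin n (by omega) hPn
    have hmT : m < T := by
      obtain ⟨j, h1, h2, _⟩ := hT ⟨0, ha⟩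
      omega
    have hnot := hmin (T - 1) (by omega)
    obtain ⟨v, hv⟩ := not_forall.mp hnot
    obtain ⟨t, ht0, htm, htl, htc⟩ := ih T hTn (by
      intro w
      obtain ⟨ρ, h1, h2, h3⟩ := h (Fin.cons v w)
      refine ⟨fun i => ρ i.succ, fun i j hij => h1 (Fin.succ_lt_succ_iff.mpr hij), ?_, ?_⟩
      · intro i
        have h4 : (ρ 0 : ℕ) < ρ i.succ := h1 (Fin.succ_pos i)
        have h5 : ¬ (ρ 0 : ℕ) < T - 1 := fun hc =>
          hv ⟨ρ 0, h2 0, hc, by simpa using (h3 0).symm⟩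
        show T ≤ (ρ i.succ : ℕ)
        omega
      · intro i
        simpa using h3 i.succ)
    refine ⟨Fin.cons m t, rfl, ?_, ?_, ?_⟩
    · rw [Fin.strictMono_iff_lt_succ]
      intro i
      refine Fin.cases ?_ (fun i => ?_) i
      · simpa [ht0] using hmT
      · rw [← Fin.succ_castSucc, Fin.cons_succ, Fin.cons_succ]
        exact htm (Fin.castSucc_lt_succ)
    · rw [← Fin.succ_last, Fin.cons_succ]
      exact htl
    · intro i
      refine Fin.cases ?_ (fun i => ?_) i
      · intro v
        obtain ⟨j, h1, h2, h3⟩ := hT v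
        refine ⟨j, by simpa using h1, ?_, h3⟩
        rw [Fin.cons_succ, ht0]
        exact h2
      · intro v
        rw [← Fin.succ_castSucc, Fin.cons_succ, Fin.cons_succ]
        exact htc i v

/-- A sequence is `k`-omni iff it contains `k` disjoint coupon collections:
there are cut points `0 = t₀ < t₁ < ⋯ < t_k ≤ n` such that within each block of
positions `t_{i-1} ≤ j < t_i` (zero-indexed, i.e. positions `(t_{i-1}, t_i]`
one-indexed) every letter of the alphabet appears. -/
theorem omni_iff_coupon_collections (n a k : ℕ) (ha : 1 ≤ a) (s : Fin n → Fin a) :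
    IsKOmni a k s ↔
      ∃ t : Fin (k + 1) → ℕ, t 0 = 0 ∧ StrictMono t ∧ t (Fin.last k) ≤ n ∧
        ∀ i : Fin k, ∀ v : Fin a, ∃ j : Fin n,
          t i.castSucc ≤ (j : ℕ) ∧ (j : ℕ) < t i.succ ∧ s j = v := by
  constructor
  · intro h
    refine omni_aux n a ha s k 0 (Nat.zero_le _) (fun w => ?_)
    obtain ⟨ρ, h1, h2⟩ := h w
    exact ⟨ρ, h1, fun _ => Nat.zero_le _, h2⟩
  · rintro ⟨t, _, htm, _, hc⟩ w
    choose j h1 h2 h3 using hc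
    refine ⟨fun i => j i (w i), ?_, fun i => (h3 i (w i)).symm⟩
    intro i i' hii
    have h4 : t i.succ ≤ t i'.castSucc := htm.monotone (by
      rw [Fin.le_def]
      simpa using hii)
    exact Fin.lt_def.mpr <| lt_of_lt_of_le (h2 i (w i)) (h4.trans (h1 i' (w i')))
end
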